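/- Let K be a field, n = 2m−1, S = K[x₁,…,xₙ], let X be the m×m generic Hankel matrix with entries x₁,…,xₙ, P₁ the matrix obtained by dropping the last row of X, P₂ the matrix obtained by dropping the first column of X, and Q the matrix obtained by dropping both. Then for the admissible values of t, the rings S/(I_t(X)+I_{t−1}(Q)) and S/(I_{t−1}(P₁)+I_{t−1}(P₂)) are Gorenstein, and ht(I_t(X)+I_{t−1}(Q)) = n−2t+3 and ht(I_{t−1}(P₁)+I_{t−1}(P₂)) = n−2t+4; that is, each sum has height one more than the common height of its two summands. -/

import Mathlib

/-- `I_t(M)` : the ideal generated by the `t × t` minors of a matrix `M`. -/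
noncomputable def minorsIdeal {R : Type*} [CommRing R] {r s : ℕ} (t : ℕ)
    (M : Matrix (Fin r) (Fin s) R) : Ideal R :=
  Ideal.span {d | ∃ (ρ : Fin t → Fin r) (γ : Fin t → Fin s),
    StrictMono ρ ∧ StrictMono γ ∧ d = (M.submatrix ρ γ).det}

section SquareHankel

variable (K : Type*) [Field K] (m : ℕ)

/-- `X` : the generic `m × m` Hankel matrix with entries `x₁, …, x_{2m-1}`
(zero-indexed: entry `(i,j)` is `X (i+j)`). -/
noncomputable def hankelX : Matrix (Fin m) (Fin m) (MvPolynomial (Fin (2 * m - 1)) K) :=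
  fun i j => MvPolynomial.X ⟨i.1 + j.1, by have := i.isLt; have := j.isLt; omega⟩

/-- `P₁` : the `(m-1) × m` Hankel matrix obtained from `X` by dropping the last row. -/
noncomputable def hankelP1 : Matrix (Fin (m - 1)) (Fin m) (MvPolynomial (Fin (2 * m - 1)) K) :=
  fun i j => MvPolynomial.X ⟨i.1 + j.1, by have := i.isLt; have := j.isLt; omega⟩

/-- `P₂` : the `m × (m-1)` Hankel matrix obtained from `X` by dropping the first column. -/
noncomputable def hankelP2 : Matrix (Fin m) (Fin (m - 1)) (MvPolynomial (Fin (2 * m - 1)) K) :=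
  fun i j => MvPolynomial.X ⟨i.1 + j.1 + 1, by have := i.isLt; have := j.isLt; omega⟩

/-- `Q` : the `(m-1) × (m-1)` Hankel matrix obtained from `X` by dropping the last row and
the first column. -/
noncomputable def hankelQ :
    Matrix (Fin (m - 1)) (Fin (m - 1)) (MvPolynomial (Fin (2 * m - 1)) K) :=
  fun i j => MvPolynomial.X ⟨i.1 + j.1 + 1, by have := i.isLt; have := j.isLt; omega⟩

end SquareHankel

open CategoryTheory in
/-- A commutative Noetherian ring is *Gorenstein* if it has finite injective dimension as a
module over itself, expressed here by the vanishing of `Ext^i(M, R)` for all modules `M` and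
all sufficiently large `i`. -/
def IsGorensteinRing (R : Type*) [CommRing R] : Prop :=
  IsNoetherianRing R ∧ ∃ d : ℕ, ∀ (M : ModuleCat R) (i : ℕ), d < i →
    Subsingleton (((Ext R (ModuleCat R) i).obj (Opposite.op M)).obj (ModuleCat.of R R))

/-- The height of an ideal: the infimum of the heights of its minimal primes. -/
noncomputable def idealHeight {R : Type*} [CommRing R] (I : Ideal R) : ℕ∞ :=
  ⨅ (p : PrimeSpectrum R) (_ : p.asIdeal ∈ I.minimalPrimes), Order.height p

universe u

set_option linter.style.haveILetI false

namespace HK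

open scoped TensorProduct

/-- `A` is the polynomial ring over `B` in the variable `θ`. -/
def IsPolyExt (B A : Type*) [CommRing B] [CommRing A] [Algebra B A] (θ : A) : Prop :=
  Function.Bijective (Polynomial.aeval (R := B) θ)

noncomputable def IsPolyExt.equiv {B A : Type*} [CommRing B] [CommRing A] [Algebra B A] {θ : A}
    (h : IsPolyExt B A θ) : Polynomial B ≃ₐ[B] A :=
  AlgEquiv.ofBijective (Polynomial.aeval θ) h

lemma IsPolyExt.equiv_apply {B A : Type*} [CommRing B] [CommRing A] [Algebra B A] {θ : A}
    (h : IsPolyExt B A θ) (p : Polynomial B) : h.equiv p = Polynomial.aeval θ p := rfl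

noncomputable def IsPolyExt.basis {B A : Type*} [CommRing B] [CommRing A] [Algebra B A] {θ : A}
    (h : IsPolyExt B A θ) : Module.Basis ℕ B A :=
  (Polynomial.basisMonomials B).map h.equiv.toLinearEquiv

lemma IsPolyExt.basis_apply {B A : Type*} [CommRing B] [CommRing A] [Algebra B A] {θ : A}
    (h : IsPolyExt B A θ) (k : ℕ) : h.basis k = θ ^ k := by
  simp [IsPolyExt.basis, IsPolyExt.equiv_apply]

lemma projective_trans (B A : Type*) [CommRing B] [CommRing A] [Algebra B A]
    [Module.Projective B A] (M : Type*) [AddCommGroup M] [Module A M] [Module B M]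
    [IsScalarTower B A M] [hM : Module.Projective A M] : Module.Projective B M := by
  obtain ⟨s, hs⟩ := (Module.projective_def' (R := A) (P := M)).1 hM
  classical
  haveI : Module.Projective B (M →₀ A) :=
    Module.Projective.of_equiv' (finsuppLequivDFinsupp (ι := M) (M := A) B).symm
  refine Module.Projective.of_split (M := M →₀ A) (s.restrictScalars B)
    ((Finsupp.linearCombination A id).restrictScalars B) ?_
  ext x
  exact LinearMap.congr_fun hs x

/-- Syzygies. -/
def Syz (A : Type u) [CommRing A] : ℕ → ∀ (M : Type u) [AddCommGroup M] [Module A M], Prop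
  | 0, _, _, _ => True
  | n + 1, M, _, _ => ∃ (P : Type u) (_ : AddCommGroup P) (_ : Module A P) (f : M →ₗ[A] P),
      Module.Projective A P ∧ Function.Injective f ∧ Syz A n (P ⧸ LinearMap.range f)

lemma Syz.of_equiv {A : Type u} [CommRing A] : ∀ (n : ℕ) {M N : Type u} [AddCommGroup M]
    [Module A M] [AddCommGroup N] [Module A N] (_ : M ≃ₗ[A] N), Syz A n M → Syz A n N
  | 0, _, _, _, _, _, _, _, _ => trivial
  | n + 1, M, N, _, _, _, _, e, ⟨P, _, _, f, hP, hf, h⟩ => by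
    refine ⟨P, _, _, f.comp e.symm.toLinearMap, hP, ?_, ?_⟩
    · exact hf.comp e.symm.injective
    · refine Syz.of_equiv n (Submodule.quotEquivOfEq _ _ ?_) h
      rw [LinearMap.range_comp, LinearEquiv.range, Submodule.map_top]

lemma Syz.of_exact {A : Type u} [CommRing A] (n : ℕ) {M P N : Type u} [AddCommGroup M]
    [Module A M] [AddCommGroup N] [Module A N] [AddCommGroup P] [Module A P]
    (f : M →ₗ[A] P) (g : P →ₗ[A] N) [Module.Projective A P] (hf : Function.Injective f)
    (hg : Function.Surjective g) (hfg : Function.Exact f g) (h : Syz A n N) :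
    Syz A (n + 1) M := by
  refine ⟨P, _, _, f, inferInstance, hf, ?_⟩
  refine Syz.of_equiv n ?_ h
  have : LinearMap.ker g = LinearMap.range f := hfg.linearMap_ker_eq
  exact ((Submodule.quotEquivOfEq _ _ this.symm).trans (g.quotKerEquivOfSurjective hg)).symm

lemma Syz.pred {A : Type u} [CommRing A] : ∀ (n : ℕ) {M : Type u} [AddCommGroup M]
    [Module A M], Syz A (n + 1) M → Syz A n M
  | 0, _, _, _, _ => trivial
  | n + 1, _, _, _, ⟨P, _, _, f, hP, hf, h⟩ => ⟨P, _, _, f, hP, hf, Syz.pred n h⟩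

lemma Syz.mono {A : Type u} [CommRing A] {n k : ℕ} (hnk : n ≤ k) {M : Type u} [AddCommGroup M]
    [Module A M] (h : Syz A k M) : Syz A n M := by
  induction hnk with
  | refl => exact h
  | step _ ih => exact ih (Syz.pred _ h)

/-- Finite global dimension. -/
def GD (A : Type u) [CommRing A] (d : ℕ) : Prop :=
  ∀ (M : Type u) [AddCommGroup M] [Module A M], Syz A d M → Module.Projective A M

lemma GD_of_isField (A : Type u) [CommRing A] (h : IsField A) : GD A 0 := by
  intro M _ _ _
  letI := h.toField
  exact @Module.Projective.of_free A _ M _ _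
    (@Module.Free.of_divisionRing A M h.toField.toDivisionRing _ _)

lemma Syz.restrict {B A : Type u} [CommRing B] [CommRing A] [Algebra B A] [Module.Projective B A] :
    ∀ (n : ℕ) (M : Type u) [AddCommGroup M] [Module A M] [Module B M] [IsScalarTower B A M],
      Syz A n M → Syz B n M
  | 0, _, _, _, _, _, _ => trivial
  | n + 1, M, _, _, _, _, ⟨P, _, _, f, hP, hf, h⟩ => by
    letI : Module B P := Module.compHom P (algebraMap B A)
    haveI : IsScalarTower B A P := IsScalarTower.of_algebraMap_smul (fun _ _ => rfl)
    refine ⟨P, _, _, f.restrictScalars B, projective_trans B A P, hf, ?_⟩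
    have h1 := Syz.restrict (B := B) n (P ⧸ LinearMap.range f) h
    exact Syz.of_equiv n
      (Submodule.Quotient.restrictScalarsEquiv B (LinearMap.range f)).symm h1

section LemmaT
variable {B A : Type u} [CommRing B] [CommRing A] [Algebra B A] {θ : A} (hθ : IsPolyExt B A θ)
  (M : Type u) [AddCommGroup M] [Module A M] [Module B M] [IsScalarTower B A M]

/-- The multiplication map `A ⊗ M → M`. -/
noncomputable def tmul (B A M : Type u) [CommRing B] [CommRing A] [Algebra B A] [AddCommGroup M]
    [Module A M] [Module B M] [IsScalarTower B A M] : A ⊗[B] M →ₗ[A] M :=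
  TensorProduct.AlgebraTensorModule.lift
    { toFun := fun a => a • (LinearMap.id : M →ₗ[B] M)
      map_add' := fun a b => by simp [add_smul]
      map_smul' := fun a b => by simp [mul_smul] }

@[simp] lemma tmul_tmul (a : A) (m : M) : tmul B A M (a ⊗ₜ[B] m) = a • m := by
  simp [tmul]

/-- the map δ -/
noncomputable def tdelta (B : Type u) {A : Type u} (M : Type u) [CommRing B] [CommRing A]
    [Algebra B A] [AddCommGroup M]
    [Module A M] [Module B M] [IsScalarTower B A M] (θ : A) : A ⊗[B] M →ₗ[A] A ⊗[B] M :=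
  θ • LinearMap.id - TensorProduct.AlgebraTensorModule.map LinearMap.id
    (θ • (LinearMap.id : M →ₗ[B] M))

lemma tdelta_tmul (a : A) (m : M) :
    tdelta B M θ (a ⊗ₜ[B] m) = (θ * a) ⊗ₜ m - a ⊗ₜ (θ • m) := by
  simp [tdelta, TensorProduct.smul_tmul']

noncomputable def tdiv : A ⊗[B] M →ₗ[B] A ⊗[B] M :=
  TensorProduct.lift (hθ.basis.constr B (fun k => ∑ i ∈ Finset.range k,
    (TensorProduct.mk B A M (θ ^ i)).comp (θ ^ (k - 1 - i) • (LinearMap.id : M →ₗ[B] M))))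

lemma tdiv_tmul (k : ℕ) (m : M) :
    tdiv hθ M ((θ ^ k) ⊗ₜ m) = ∑ i ∈ Finset.range k, (θ ^ i) ⊗ₜ (θ ^ (k - 1 - i) • m) := by
  rw [tdiv, TensorProduct.lift.tmul, ← hθ.basis_apply k, Module.Basis.constr_basis]
  simp [LinearMap.sum_apply]

lemma tensor_ind {B A : Type u} [CommRing B] [CommRing A] [Algebra B A] {θ : A}
    (hθ : IsPolyExt B A θ) {M : Type u} [AddCommGroup M] [Module B M]
    (P : A ⊗[B] M → Prop) (hadd : ∀ x y, P x → P y → P (x + y)) (h0 : P 0)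
    (h : ∀ k m, P ((θ ^ k) ⊗ₜ m)) (x : A ⊗[B] M) : P x := by
  induction x with
  | zero => exact h0
  | add x y hx hy => exact hadd x y hx hy
  | tmul a m =>
    have ha : a ∈ Submodule.span B (Set.range hθ.basis) := by rw [hθ.basis.span_eq]; trivial
    induction ha using Submodule.span_induction generalizing m with
    | mem x hx => obtain ⟨k, rfl⟩ := hx; rw [hθ.basis_apply]; exact h k m
    | zero => simpa using h0
    | add x y _ _ hx hy => rw [TensorProduct.add_tmul]; exact hadd _ _ (hx m) (hy m)
    | smul b x _ hx => rw [TensorProduct.smul_tmul]; exact hx _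

lemma tdiv_tdelta (x : A ⊗[B] M) : tdiv hθ M (tdelta B M θ x) = x := by
  induction x using tensor_ind hθ with
  | hadd x y hx hy => rw [map_add, map_add, hx, hy]
  | h0 => simp
  | h k m =>
    rw [tdelta_tmul, map_sub, ← pow_succ', tdiv_tmul, tdiv_tmul, Finset.sum_range_succ]
    have : ∀ i ∈ Finset.range k, (θ ^ i) ⊗ₜ[B] (θ ^ (k + 1 - 1 - i) • m) =
        (θ ^ i) ⊗ₜ (θ ^ (k - 1 - i) • θ • m) := by
      intro i hi
      rw [Finset.mem_range] at hi
      rw [smul_smul, ← pow_succ]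
      congr 3
      omega
    rw [Finset.sum_congr rfl this]
    simp

lemma tdelta_tdiv (x : A ⊗[B] M) : tdelta B M θ (tdiv hθ M x) = x - 1 ⊗ₜ (tmul B A M x) := by
  induction x using tensor_ind hθ with
  | hadd x y hx hy =>
    rw [map_add, map_add, hx, hy, map_add, TensorProduct.tmul_add]; abel
  | h0 => simp
  | h k m =>
    rw [tdiv_tmul, map_sum]
    have : ∀ i ∈ Finset.range k, tdelta B M θ ((θ ^ i) ⊗ₜ[B] (θ ^ (k - 1 - i) • m)) =
        (θ ^ (i + 1)) ⊗ₜ (θ ^ (k - (i + 1)) • m) - (θ ^ i) ⊗ₜ (θ ^ (k - i) • m) := by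
      intro i hi
      rw [Finset.mem_range] at hi
      rw [tdelta_tmul, ← pow_succ', smul_smul, ← pow_succ']
      congr 4 <;> omega
    rw [Finset.sum_congr rfl this,
      Finset.sum_range_sub (fun i => (θ ^ i) ⊗ₜ[B] (θ ^ (k - i) • m))]
    simp

/-- Lemma T. -/
lemma ker_tmul_projective {B A : Type u} [CommRing B] [CommRing A] [Algebra B A] {θ : A}
    (hθ : IsPolyExt B A θ)
    (M : Type u) [AddCommGroup M] [Module A M] [Module B M] [IsScalarTower B A M] [Module.Projective B M] :
    Module.Projective A (LinearMap.ker (tmul B A M)) := by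
  have hmem : ∀ x, tdelta B M θ x ∈ LinearMap.ker (tmul B A M) := by
    intro x
    induction x using tensor_ind hθ with
    | hadd x y hx hy => rw [map_add]; exact add_mem hx hy
    | h0 => simp
    | h k m =>
      rw [LinearMap.mem_ker, tdelta_tmul, map_sub, tmul_tmul, tmul_tmul, smul_smul, mul_comm,
        sub_self]
  let f : A ⊗[B] M →ₗ[A] LinearMap.ker (tmul B A M) := (tdelta B M θ).codRestrict _ hmem
  have hf : Function.Bijective f := by
    constructor
    · intro x y h
      have := congrArg (fun z => tdiv hθ M z.1) h
      simpa [f, tdiv_tdelta] using this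
    · rintro ⟨x, hx⟩
      refine ⟨tdiv hθ M x, ?_⟩
      ext
      rw [LinearMap.mem_ker] at hx
      simp [f, tdelta_tdiv, hx]
  exact Module.Projective.of_equiv' (LinearEquiv.ofBijective f hf)

lemma tmul_surjective : Function.Surjective (tmul B A M) := fun m => ⟨1 ⊗ₜ m, by simp⟩

end LemmaT

/-- If `N` has a two-term projective resolution then every first syzygy is projective. -/
lemma schanuel {A : Type u} [CommRing A] {P Q N : Type u} [AddCommGroup P] [Module A P]
    [AddCommGroup Q] [Module A Q] [AddCommGroup N] [Module A N] (p : P →ₗ[A] N) (q : Q →ₗ[A] N)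
    (hp : Function.Surjective p) (hq : Function.Surjective q)
    [Module.Projective A P] [Module.Projective A Q]
    [Module.Projective A (LinearMap.ker p)] : Module.Projective A (LinearMap.ker q) := by
  -- lift p through q and vice versa
  obtain ⟨s, hs⟩ := Module.projective_lifting_property q p hq
  obtain ⟨t, ht⟩ := Module.projective_lifting_property p q hp
  have hs' : ∀ x, q (s x) = p x := fun x => LinearMap.congr_fun hs x
  have ht' : ∀ x, p (t x) = q x := fun x => LinearMap.congr_fun ht x
  -- ker q is a retract of ker p × Q
  let i : LinearMap.ker q →ₗ[A] LinearMap.ker p × Q :=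
    LinearMap.prod (((t.comp (Submodule.subtype _))).codRestrict _ (fun x => by
      rw [LinearMap.mem_ker]; simp [ht'])) (Submodule.subtype _)
  let r : LinearMap.ker p × Q →ₗ[A] LinearMap.ker q :=
    LinearMap.codRestrict _ ((s.comp (Submodule.subtype _)).comp (LinearMap.fst _ _ _) +
      ((LinearMap.id - s.comp t).comp (LinearMap.snd _ _ _))) (fun x => by
        rw [LinearMap.mem_ker]
        simp [hs', ht'])
  refine Module.Projective.of_split i r ?_
  ext x
  simp [i, r]

lemma GD.succ {B A : Type u} [CommRing B] [CommRing A] [Algebra B A] {θ : A}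
    (hθ : IsPolyExt B A θ) {d : ℕ} (h : GD B d) : GD A (d + 1) := by
  intro M _ _ hM
  haveI : Module.Projective B A := Module.Projective.of_basis hθ.basis
  obtain ⟨P, _, _, f, hP, hf, hS⟩ := hM
  let N := P ⧸ LinearMap.range f
  letI : Module B N := Module.compHom N (algebraMap B A)
  haveI : IsScalarTower B A N := IsScalarTower.of_algebraMap_smul (fun _ _ => rfl)
  haveI : Module.Projective B N := h N (Syz.restrict d N hS)
  haveI := ker_tmul_projective hθ N
  have := schanuel (tmul B A N) (LinearMap.range f).mkQ (tmul_surjective N)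
    (Submodule.mkQ_surjective _)
  rw [Submodule.ker_mkQ] at this
  exact Module.Projective.of_equiv' (LinearEquiv.ofInjective f hf).symm

end HK

namespace HK

open scoped TensorProduct Pointwise

section LemmaL
variable {B A : Type u} [CommRing B] [CommRing A] [Algebra B A] {θ : A}

lemma exists_monic_kill (θ : A) (P : Type u) [AddCommGroup P] [Module A P] [Module B P]
    [IsScalarTower B A P] [Module.Finite B P] :
    ∃ χ : Polynomial B, χ.Monic ∧ ∀ p : P, Polynomial.aeval θ χ • p = 0 := by
  obtain ⟨χ, h1, h2⟩ := LinearMap.exists_monic_and_aeval_eq_zero B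
    (Algebra.lsmul B B P θ : Module.End B P)
  refine ⟨χ, h1, fun p => ?_⟩
  rw [Polynomial.aeval_algHom_apply] at h2
  exact LinearMap.congr_fun h2 p

lemma monic_mem_nonZeroDivisors (hθ : IsPolyExt B A θ) {χ : Polynomial B} (h : χ.Monic) (a : A)
    (ha : Polynomial.aeval θ χ * a = 0) : a = 0 := by
  obtain ⟨p, rfl⟩ := hθ.2 a
  rw [← map_mul] at ha
  have h0 : χ * p = 0 := hθ.1 (by rw [ha, map_zero])
  rw [(h.mul_right_eq_zero_iff).1 h0, map_zero]

lemma monic_smul_eq_zero (hθ : IsPolyExt B A θ) {χ : Polynomial B} (h : χ.Monic)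
    {F : Type u} [AddCommGroup F] [Module A F] [hF : Module.Projective A F] (x : F)
    (hx : Polynomial.aeval θ χ • x = 0) : x = 0 := by
  obtain ⟨s, hs⟩ := (Module.projective_def (R := A) (P := F)).1 hF
  apply hs.injective
  rw [map_zero]
  ext y
  apply monic_mem_nonZeroDivisors hθ h
  have := DFunLike.congr_fun (congrArg s hx) y
  simpa using this

lemma quot_monic_projective (hθ : IsPolyExt B A θ) {χ : Polynomial B} (h : χ.Monic) :
    Module.Projective B (A ⧸ Ideal.span {Polynomial.aeval θ χ}) := by
  haveI := h.free_quotient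
  have e : (Polynomial B ⧸ Ideal.span {χ}) ≃ₐ[B] A ⧸ Ideal.span {Polynomial.aeval θ χ} :=
    Ideal.quotientEquivAlg _ _ hθ.equiv (by
      rw [Ideal.map_span, Set.image_singleton]; rfl)
  exact Module.Projective.of_equiv' e.toLinearEquiv

lemma quotSMulTop_projective (hθ : IsPolyExt B A θ) {χ : Polynomial B} (h : χ.Monic)
    (F : Type u) [AddCommGroup F] [Module A F] [Module B F] [IsScalarTower B A F]
    [hF : Module.Projective A F] :
    Module.Projective B (QuotSMulTop (Polynomial.aeval θ χ) F) := by
  haveI := quot_monic_projective hθ h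
  have e := (QuotSMulTop.equivQuotTensor (Polynomial.aeval θ χ) F).restrictScalars B
  haveI : Module.Projective B ((A ⧸ Ideal.span {Polynomial.aeval θ χ}) ⊗[A] F) :=
    projective_trans B (A ⧸ Ideal.span {Polynomial.aeval θ χ}) _
  exact Module.Projective.of_equiv' e.symm

lemma lemmaL (hθ : IsPolyExt B A θ) {d : ℕ} (hd : GD B d)
    (F : Type u) [AddCommGroup F] [Module A F] [Module B F] [IsScalarTower B A F]
    [Module.Projective A F] (N : Submodule A F) [Module.Projective A N]
    [Module.Finite B (F ⧸ N)] : Module.Projective B (F ⧸ N) := by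
  obtain ⟨χ, hχ, hk⟩ := exists_monic_kill (B := B) θ (F ⧸ N)
  have hcN : ∀ x : F, Polynomial.aeval θ χ • x ∈ N := by
    intro x
    rw [← Submodule.Quotient.mk_eq_zero, Submodule.Quotient.mk_smul]
    exact hk _
  have hinj : ∀ x : F, Polynomial.aeval θ χ • x = 0 → x = 0 := fun x =>
    monic_smul_eq_zero hθ hχ x
  haveI h1 := quotSMulTop_projective hθ hχ F
  haveI h2 := quotSMulTop_projective hθ hχ N
  generalize Polynomial.aeval θ χ = c at *
  let Q := N ⧸ (Submodule.comap N.subtype (c • (⊤ : Submodule A F)))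
  let f1 : Q →ₗ[A] QuotSMulTop c F := Submodule.mapQ _ _ N.subtype le_rfl
  have hf1 : Function.Injective f1 := by
    rw [← LinearMap.ker_eq_bot, LinearMap.ker_eq_bot']
    intro x hx
    obtain ⟨x, rfl⟩ := Submodule.Quotient.mk_surjective _ x
    rw [Submodule.mapQ_apply, Submodule.Quotient.mk_eq_zero] at hx
    rw [Submodule.Quotient.mk_eq_zero]
    exact hx
  have hle : c • (⊤ : Submodule A F) ≤ N := by
    rintro _ ⟨x, -, rfl⟩
    exact hcN x
  let g1 : QuotSMulTop c F →ₗ[A] F ⧸ N := Submodule.mapQ _ _ LinearMap.id hle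
  have hg1 : Function.Surjective g1 := by
    intro x
    obtain ⟨x, rfl⟩ := Submodule.Quotient.mk_surjective _ x
    exact ⟨Submodule.Quotient.mk x, rfl⟩
  have he1 : Function.Exact f1 g1 := by
    intro x
    obtain ⟨x, rfl⟩ := Submodule.Quotient.mk_surjective _ x
    constructor
    · intro h
      have h : x ∈ N := by
        rw [← Submodule.Quotient.mk_eq_zero]; exact h
      exact ⟨Submodule.Quotient.mk ⟨x, h⟩, rfl⟩
    · rintro ⟨y, hy⟩
      rw [← hy]
      obtain ⟨y, rfl⟩ := Submodule.Quotient.mk_surjective _ y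
      change Submodule.Quotient.mk (y : F) = 0
      rw [Submodule.Quotient.mk_eq_zero]
      exact y.2
  let f2' : F →ₗ[A] QuotSMulTop c N :=
    (Submodule.mkQ _).comp ((c • (LinearMap.id : F →ₗ[A] F)).codRestrict N hcN)
  have hf2' : ∀ x, f2' x = Submodule.Quotient.mk ⟨c • x, hcN x⟩ := fun _ => rfl
  have hker : LinearMap.ker f2' = N := by
    ext x
    rw [LinearMap.mem_ker, hf2', Submodule.Quotient.mk_eq_zero]
    constructor
    · rintro ⟨y, -, hy⟩
      have : c • (x - y) = 0 := by
        have := congrArg Subtype.val hy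
        simp only [DistribSMul.toLinearMap_apply, Submodule.coe_smul] at this
        rw [smul_sub, this, sub_self]
      rw [sub_eq_zero.1 (hinj _ this)]
      exact y.2
    · intro hx
      exact ⟨⟨x, hx⟩, trivial, rfl⟩
  let f2 : F ⧸ N →ₗ[A] QuotSMulTop c N := N.liftQ f2' hker.ge
  have hf2 : Function.Injective f2 := by
    rw [← LinearMap.ker_eq_bot]
    exact Submodule.ker_liftQ_eq_bot _ _ _ hker.le
  let g2 : QuotSMulTop c N →ₗ[A] Q := Submodule.mapQ _ _ LinearMap.id (by
    rintro _ ⟨x, -, rfl⟩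
    exact ⟨x, trivial, rfl⟩)
  have hg2 : Function.Surjective g2 := by
    intro x
    obtain ⟨x, rfl⟩ := Submodule.Quotient.mk_surjective _ x
    exact ⟨Submodule.Quotient.mk x, rfl⟩
  have he2 : Function.Exact f2 g2 := by
    intro x
    obtain ⟨x, rfl⟩ := Submodule.Quotient.mk_surjective _ x
    constructor
    · intro h
      have h : x ∈ Submodule.comap N.subtype (c • (⊤ : Submodule A F)) := by
        rw [← Submodule.Quotient.mk_eq_zero]; exact h
      obtain ⟨y, -, hy⟩ := h
      refine ⟨Submodule.Quotient.mk y, ?_⟩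
      change f2' y = _
      rw [hf2']
      congr 1
      exact Subtype.ext hy
    · rintro ⟨y, hy⟩
      rw [← hy]
      obtain ⟨y, rfl⟩ := Submodule.Quotient.mk_surjective _ y
      change Submodule.Quotient.mk (⟨c • y, hcN y⟩ : N) = 0
      rw [Submodule.Quotient.mk_eq_zero]
      exact ⟨y, trivial, rfl⟩
  have key : ∀ n, Syz B n (F ⧸ N) ∧ Syz B n Q := by
    intro n
    induction n with
    | zero => exact ⟨trivial, trivial⟩
    | succ n ih =>
      exact ⟨Syz.of_exact n (f2.restrictScalars B) (g2.restrictScalars B) hf2 hg2 he2 ih.2,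
        Syz.of_exact n (f1.restrictScalars B) (g1.restrictScalars B) hf1 hg1 he1 ih.1⟩
  exact hd _ (key d).1

/-- Variant with maps. -/
lemma lemmaL' (hθ : IsPolyExt B A θ) {d : ℕ} (hd : GD B d)
    (F P : Type u) [AddCommGroup F] [Module A F]
    [AddCommGroup P] [Module A P] [Module B P] [IsScalarTower B A P]
    [Module.Projective A F] (π : F →ₗ[A] P) (hπ : Function.Surjective π)
    [Module.Projective A (LinearMap.ker π)]
    [Module.Finite B P] : Module.Projective B P := by
  letI : Module B F := Module.compHom F (algebraMap B A)
  haveI : IsScalarTower B A F := IsScalarTower.of_algebraMap_smul (fun _ _ => rfl)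
  let e := (π.quotKerEquivOfSurjective hπ).restrictScalars B
  haveI : Module.Finite B (F ⧸ LinearMap.ker π) := Module.Finite.equiv e.symm
  haveI := lemmaL hθ hd F (LinearMap.ker π)
  exact Module.Projective.of_equiv' e

lemma exchange {B' : Type u} [CommRing B'] [Algebra B' A] {θ' : A} (hθ : IsPolyExt B A θ)
    (hθ' : IsPolyExt B' A θ') {d : ℕ} (hd : GD B' d)
    (M : Type u) [AddCommGroup M] [Module A M] [Module B M] [IsScalarTower B A M]
    [Module B' M] [IsScalarTower B' A M] [Module.Projective B M] [Module.Finite B' M] :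
    Module.Projective B' M := by
  haveI := ker_tmul_projective hθ M
  exact lemmaL' hθ' hd (A ⊗[B] M) M (tmul B A M) (tmul_surjective M)

end LemmaL

end HK

namespace HK

open scoped TensorProduct Pointwise

/-- lifting of functionals along a perfect form -/
lemma perfect_lift {B A R M : Type*} [CommRing B] [CommRing A] [Algebra B A] [AddCommGroup R]
    [Module A R] [Module B R] [IsScalarTower B A R] [AddCommGroup M] [Module A M] [Module B M]
    [IsScalarTower B A M] (I : Ideal A) (ρ : R →ₗ[B] B)
    (h2 : ∀ ψ : A →ₗ[B] B, (∀ a ∈ I, ψ a = 0) → ∃ r : R, ∀ a, ψ a = ρ (a • r))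
    (h3 : ∀ r : R, (∀ a : A, ρ (a • r) = 0) → r = 0)
    (hM : ∀ a ∈ I, ∀ m : M, a • m = 0) (f : M →ₗ[B] B) :
    ∃ h : M →ₗ[A] R, ∀ m, ρ (h m) = f m := by
  have key : ∀ m : M, ∃ r : R, ∀ a : A, f (a • m) = ρ (a • r) := by
    intro m
    exact h2 (f.comp ((LinearMap.toSpanSingleton A M m).restrictScalars B))
      (fun a ha => by simp [hM a ha m])
  choose h hh using key
  refine ⟨⟨⟨h, ?_⟩, ?_⟩, ?_⟩
  · intro x y
    rw [← sub_eq_zero]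
    apply h3
    intro a
    rw [smul_sub, map_sub, ← hh, smul_add, smul_add, map_add, map_add, ← hh, ← hh, sub_self]
  · intro c x
    rw [← sub_eq_zero]
    apply h3
    intro a
    rw [smul_sub, map_sub, ← hh, RingHom.id_apply, smul_smul, smul_smul, ← hh, sub_self]
  · intro m
    have := hh m 1
    simpa using this.symm

section Res
open Polynomial
variable {B : Type*} [CommRing B]

/-- the residue functional -/
noncomputable def res (χ : B[X]) : B[X] →ₗ[B] B :=
  (lcoeff B (χ.natDegree - 1)).comp (modByMonicHom χ)

lemma res_apply (χ p : B[X]) : res χ p = (p %ₘ χ).coeff (χ.natDegree - 1) := rfl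

lemma res_mul (χ p : B[X]) (hχ : χ.Monic) : res χ (χ * p) = 0 := by
  rw [res_apply, (modByMonic_eq_zero_iff_dvd hχ).2 ⟨p, rfl⟩, coeff_zero]

lemma res_of_lt [Nontrivial B] (χ p : B[X]) (hχ : χ.Monic) (hp : p.degree < χ.degree) :
    res χ p = p.coeff (χ.natDegree - 1) := by
  rw [res_apply, (modByMonic_eq_self_iff hχ).2 hp]

lemma res_exists (χ : B[X]) (hχ : χ.Monic) (hd : 0 < χ.natDegree) (ψ : B[X] →ₗ[B] B)
    (hψ : ∀ p, ψ (χ * p) = 0) : ∃ q, ∀ p, ψ p = res χ (p * q) := by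
  nontriviality B
  have step : ∀ k, k ≤ χ.natDegree → ∃ q : B[X], ∀ i < k, ψ (X ^ i) = res χ (X ^ i * q) := by
    intro k
    induction k with
    | zero => intro _; exact ⟨0, by simp⟩
    | succ k ih =>
      intro hk
      obtain ⟨q, hq⟩ := ih (by omega)
      refine ⟨q + C (ψ (X ^ k) - res χ (X ^ k * q)) * X ^ (χ.natDegree - 1 - k), ?_⟩
      intro i hi
      have e1 : (X : B[X]) ^ i * (q + C (ψ (X ^ k) - res χ (X ^ k * q)) *
          X ^ (χ.natDegree - 1 - k)) = X ^ i * q + (ψ (X ^ k) - res χ (X ^ k * q)) •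
            X ^ (i + (χ.natDegree - 1 - k)) := by
        rw [smul_eq_C_mul, pow_add]; ring
      have e2 : res χ ((X : B[X]) ^ (i + (χ.natDegree - 1 - k))) = if i = k then 1 else 0 := by
        rw [res_of_lt _ _ hχ, coeff_X_pow]
        · congr 1
          apply propext
          omega
        · rw [degree_X_pow, degree_eq_natDegree hχ.ne_zero]
          exact_mod_cast (by omega)
      rw [e1, map_add, map_smul, e2]
      by_cases hik : i = k
      · subst hik; simp
      · rw [if_neg hik, hq i (by omega)]; simp
  obtain ⟨q, hq⟩ := step _ le_rfl
  refine ⟨q, fun p => ?_⟩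
  have e := modByMonic_add_div p χ
  have h1 : ψ p = ψ (p %ₘ χ) := by
    conv_lhs => rw [← e]
    rw [map_add, hψ, add_zero]
  have h2 : res χ (p * q) = res χ ((p %ₘ χ) * q) := by
    conv_lhs => rw [← e]
    rw [add_mul, map_add, mul_assoc, res_mul _ _ hχ, add_zero]
  have hlt : (p %ₘ χ).natDegree < χ.natDegree := natDegree_modByMonic_lt _ hχ (by
    rintro rfl; simp at hd)
  rw [h1, h2, (p %ₘ χ).as_sum_range' _ hlt, Finset.sum_mul, map_sum, map_sum]
  refine Finset.sum_congr rfl fun i hi => ?_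
  rw [← C_mul_X_pow_eq_monomial, ← smul_eq_C_mul, smul_mul_assoc, map_smul, map_smul,
    hq i (Finset.mem_range.1 hi)]

lemma res_unique (χ : B[X]) (hχ : χ.Monic) (q : B[X])
    (hq : ∀ p, res χ (p * q) = 0) : χ ∣ q := by
  nontriviality B
  rw [← modByMonic_eq_zero_iff_dvd hχ]
  by_contra h0
  set r := q %ₘ χ with hr
  have hlt : r.degree < χ.degree := degree_modByMonic_lt _ hχ
  have hlt' : r.natDegree < χ.natDegree := natDegree_lt_natDegree h0 hlt
  have e := modByMonic_add_div q χ
  have h1 := hq (X ^ (χ.natDegree - 1 - r.natDegree))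
  rw [← e, mul_add, map_add, mul_left_comm, res_mul _ _ hχ, add_zero, ← hr, res_of_lt _ _ hχ] at h1
  · have : χ.natDegree - 1 = r.natDegree + (χ.natDegree - 1 - r.natDegree) := by omega
    conv at h1 => lhs; rw [mul_comm]; arg 2; rw [this]
    rw [coeff_mul_X_pow, coeff_natDegree, leadingCoeff_eq_zero] at h1
    exact h0 h1
  · refine lt_of_le_of_lt (degree_mul_le _ _) ?_
    rw [degree_X_pow, degree_eq_natDegree h0, degree_eq_natDegree hχ.ne_zero]
    exact_mod_cast (by omega)

end Res

/-- The dual of `M` over `A` is generated by one element over `S`. -/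
def CycDual (A S M : Type*) [CommRing A] [CommRing S] [AddCommGroup M] [Module A M]
    [Module S M] : Prop :=
  ∃ φ : M →ₗ[A] A, ∀ ψ : M →ₗ[A] A, ∃ s : S, ∀ x, ψ x = φ (s • x)

lemma CycDual.of_equiv {A S M N : Type*} [CommRing A] [CommRing S] [AddCommGroup M] [Module A M]
    [Module S M] [AddCommGroup N] [Module A N] [Module S N] [Algebra A S] [IsScalarTower A S M]
    [IsScalarTower A S N] (e : M ≃ₗ[S] N) (h : CycDual A S M) : CycDual A S N := by
  obtain ⟨φ, hφ⟩ := h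
  refine ⟨φ.comp (e.symm.restrictScalars A).toLinearMap, fun ψ => ?_⟩
  obtain ⟨s, hs⟩ := hφ (ψ.comp (e.restrictScalars A).toLinearMap)
  refine ⟨s, fun x => ?_⟩
  have := hs (e.symm x)
  simpa using this

lemma exists_retraction {A S M : Type*} [CommRing A] [CommRing S] [AddCommGroup M] [Module A M]
    [Module S M] [Algebra A S] [IsScalarTower A S M] (N : Submodule S M)
    [Module.Projective A (M ⧸ N)] : ∃ r : M →ₗ[A] N, ∀ n : N, r n = n := by
  obtain ⟨s, hs⟩ := Module.projective_lifting_property (N.mkQ.restrictScalars A)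
    (LinearMap.id : (M ⧸ N) →ₗ[A] (M ⧸ N)) N.mkQ_surjective
  have hs' : ∀ x, N.mkQ (s x) = x := fun x => LinearMap.congr_fun hs x
  have hmem : ∀ x, ((LinearMap.id : M →ₗ[A] M) - s.comp (N.mkQ.restrictScalars A)) x
      ∈ N.restrictScalars A := by
    intro x
    rw [Submodule.restrictScalars_mem, ← Submodule.Quotient.mk_eq_zero, ← Submodule.mkQ_apply]
    have h1 := hs' (N.mkQ x)
    simp only [LinearMap.sub_apply, LinearMap.id_apply, LinearMap.comp_apply,
      LinearMap.restrictScalars_apply, map_sub, h1, sub_self]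
  refine ⟨((LinearMap.id : M →ₗ[A] M) - s.comp (N.mkQ.restrictScalars A)).codRestrict
    (N.restrictScalars A) hmem, ?_⟩
  · intro n
    apply Subtype.ext
    have : N.mkQ n = 0 := by simp
    change (n : M) - s (N.mkQ n) = n
    rw [this, map_zero, sub_zero]

lemma CycDual.sub {A S M : Type*} [CommRing A] [CommRing S] [AddCommGroup M] [Module A M]
    [Module S M] [Algebra A S] [IsScalarTower A S M] (N : Submodule S M)
    [Module.Projective A (M ⧸ N)] (h : CycDual A S M) : CycDual A S N := by
  obtain ⟨r, hr⟩ := exists_retraction (A := A) N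
  obtain ⟨φ, hφ⟩ := h
  refine ⟨φ.comp (N.subtype.restrictScalars A), fun ψ => ?_⟩
  obtain ⟨s, hs⟩ := hφ (ψ.comp r)
  refine ⟨s, fun x => ?_⟩
  have := hs x
  simpa [hr] using this

lemma projective_sub {A S M : Type*} [CommRing A] [CommRing S] [AddCommGroup M] [Module A M]
    [Module S M] [Algebra A S] [IsScalarTower A S M] (N : Submodule S M)
    [Module.Projective A (M ⧸ N)] [Module.Projective A M] : Module.Projective A N := by
  obtain ⟨r, hr⟩ := exists_retraction (A := A) N
  exact Module.Projective.of_split (N.subtype.restrictScalars A) r (by ext; simp [hr])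

/-- step alpha, module version -/
lemma alpha' {B A S F : Type u} [CommRing B] [CommRing A] [CommRing S] [Algebra B A]
    [Algebra A S] [Algebra B S] [IsScalarTower B A S] [AddCommGroup F] [Module B F]
    [Module A F] [Module S F] [IsScalarTower A S F] [IsScalarTower B S F] [IsScalarTower B A F]
    {θ : A} (hθ : IsPolyExt B A θ) {d : ℕ} (hd : GD B d) (N : Submodule S F)
    [Module.Projective A F] [Module.Projective A N] (hN : CycDual A S N)
    [Module.Finite B (F ⧸ N)] :
    Module.Projective B (F ⧸ N) ∧ CycDual B S (F ⧸ N) := by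
  constructor
  · haveI : Module.Projective A (LinearMap.ker (N.mkQ.restrictScalars A)) := by
      have : LinearMap.ker (N.mkQ.restrictScalars A) = N.restrictScalars A := by
        ext; simp
      rw [this]
      exact ‹Module.Projective A N›
    exact lemmaL' hθ hd F (F ⧸ N) (N.mkQ.restrictScalars A) N.mkQ_surjective
  · obtain ⟨χ, hχ, hk, hdeg⟩ : ∃ χ : Polynomial B, χ.Monic ∧
        (∀ p : F ⧸ N, Polynomial.aeval θ χ • p = 0) ∧ (Nontrivial B → 0 < χ.natDegree) := by
      obtain ⟨χ, hχ, hk⟩ := exists_monic_kill (B := B) θ (F ⧸ N)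
      refine ⟨χ * Polynomial.X, hχ.mul Polynomial.monic_X, fun p => ?_, fun _ => ?_⟩
      · rw [map_mul, mul_smul, hk]
      · rw [hχ.natDegree_mul Polynomial.monic_X, Polynomial.natDegree_X]; omega
    rcases subsingleton_or_nontrivial B with hB | hB
    · exact ⟨0, fun ψ => ⟨0, fun x => Subsingleton.elim _ _⟩⟩
    have hdeg := hdeg hB
    set c := Polynomial.aeval θ χ with hc
    have hcN : ∀ x : F, c • x ∈ N := by
      intro x
      rw [← Submodule.Quotient.mk_eq_zero]
      exact hk (Submodule.Quotient.mk x)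
    have hnzd : ∀ a : A, c * a = 0 → a = 0 := monic_mem_nonZeroDivisors hθ hχ
    -- the functional on A
    let r0 : A →ₗ[B] B := (res χ).comp hθ.equiv.symm.toLinearMap
    have hr0 : ∀ p, r0 (Polynomial.aeval θ p) = res χ p := by
      intro p
      change res χ (hθ.equiv.symm (hθ.equiv p)) = _
      rw [AlgEquiv.symm_apply_apply]
    have hr0c : ∀ a, r0 (c * a) = 0 := by
      intro a
      obtain ⟨p, rfl⟩ := hθ.2 a
      rw [hc, ← map_mul, hr0, res_mul _ _ hχ]
    let I : Ideal A := Ideal.span {c}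
    let ρ : (A ⧸ I) →ₗ[B] B := (Submodule.liftQ (I.restrictScalars B) r0 (by
      intro a ha
      obtain ⟨a, rfl⟩ := Ideal.mem_span_singleton'.1 ha
      rw [LinearMap.mem_ker, mul_comm, hr0c])).comp
        (Submodule.Quotient.restrictScalarsEquiv B I).symm.toLinearMap
    have hρ : ∀ a : A, ρ (Ideal.Quotient.mk I a) = r0 a := fun a => rfl
    obtain ⟨φ, hφ⟩ := hN
    -- transfer
    let cm : F →ₗ[A] N := (c • (LinearMap.id : F →ₗ[A] F)).codRestrict (N.restrictScalars A) hcN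
    have hcm : ∀ x, ((cm x : N) : F) = c • x := fun x => rfl
    have hcmN : ∀ x : N, cm x = c • x := fun x => Subtype.ext rfl
    have hcmS : ∀ (s : S) (x : F), cm (s • x) = s • cm x := by
      intro s x
      apply Subtype.ext
      rw [hcm, Submodule.coe_smul, hcm, ← algebraMap_smul S c x, smul_comm, algebraMap_smul]
    let Φ : (F ⧸ N) →ₗ[B] B := (Submodule.liftQ (N.restrictScalars B)
      (r0.comp ((φ.comp cm).restrictScalars B)) (by
        intro x hx
        rw [LinearMap.mem_ker]
        change r0 (φ (cm (⟨x, hx⟩ : N))) = 0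
        rw [hcmN, map_smul, smul_eq_mul, hr0c])).comp
        (Submodule.Quotient.restrictScalarsEquiv B N).symm.toLinearMap
    have hΦ : ∀ x, Φ (Submodule.Quotient.mk x) = r0 (φ (cm x)) := fun x => rfl
    refine ⟨Φ, fun f => ?_⟩
    obtain ⟨h, hh⟩ := perfect_lift (B := B) (A := A) (R := A ⧸ I) (M := F ⧸ N) I ρ (by
      intro ψ hψ
      obtain ⟨q, hq⟩ := res_exists χ hχ hdeg (ψ.comp hθ.equiv.toLinearMap) (by
        intro p
        apply hψ
        change hθ.equiv (χ * p) ∈ I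
        rw [map_mul]
        exact Ideal.mul_mem_right _ _ (Ideal.mem_span_singleton_self c))
      refine ⟨Ideal.Quotient.mk I (Polynomial.aeval θ q), fun a => ?_⟩
      obtain ⟨p, rfl⟩ := hθ.2 a
      have e : (Polynomial.aeval θ p • Ideal.Quotient.mk I (Polynomial.aeval θ q) : A ⧸ I) =
        Ideal.Quotient.mk I (Polynomial.aeval θ (p * q)) := by
        rw [map_mul, map_mul, Algebra.smul_def, Ideal.Quotient.algebraMap_eq]
      rw [e, hρ, hr0, ← hq]
      rfl) (by
      intro r hr
      obtain ⟨a, rfl⟩ := Ideal.Quotient.mk_surjective r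
      obtain ⟨q, rfl⟩ := hθ.2 a
      have : χ ∣ q := by
        apply res_unique χ hχ
        intro p
        have := hr (Polynomial.aeval θ p)
        have e : (Polynomial.aeval θ p • Ideal.Quotient.mk I (Polynomial.aeval θ q) : A ⧸ I) =
          Ideal.Quotient.mk I (Polynomial.aeval θ (p * q)) := by
          rw [map_mul, map_mul, Algebra.smul_def, Ideal.Quotient.algebraMap_eq]
        rwa [e, hρ, hr0] at this
      obtain ⟨p, rfl⟩ := this
      rw [Ideal.Quotient.eq_zero_iff_mem, map_mul]
      exact Ideal.mul_mem_right _ _ (Ideal.mem_span_singleton_self c)) (by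
      intro a ha m
      obtain ⟨a, rfl⟩ := Ideal.mem_span_singleton'.1 ha
      rw [mul_smul, hk, smul_zero]) f
    obtain ⟨f2, hf2⟩ := Module.projective_lifting_property (I.mkQ)
      (h.comp (N.mkQ.restrictScalars A)) I.mkQ_surjective
    have hf2' : ∀ x, Ideal.Quotient.mk I (f2 x) = h (Submodule.Quotient.mk x) :=
      fun x => LinearMap.congr_fun hf2 x
    have hex : ∀ n : N, ∃ a, f2 n = c * a := by
      intro n
      have : Ideal.Quotient.mk I (f2 n) = 0 := by
        rw [hf2', (Submodule.Quotient.mk_eq_zero N).2 n.2, map_zero]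
      obtain ⟨a, ha⟩ := Ideal.mem_span_singleton'.1 (Ideal.Quotient.eq_zero_iff_mem.1 this)
      exact ⟨a, by rw [← ha, mul_comm]⟩
    choose g hg using hex
    let g' : N →ₗ[A] A :=
      { toFun := g
        map_add' := fun x y => by
          rw [← sub_eq_zero]
          apply hnzd
          rw [mul_sub, mul_add, ← hg, ← hg, ← hg, Submodule.coe_add, map_add, sub_self]
        map_smul' := fun a x => by
          rw [← sub_eq_zero]
          apply hnzd
          have : ((a • x : N) : F) = a • (x : F) := rfl
          rw [mul_sub, RingHom.id_apply, smul_eq_mul, mul_left_comm, ← hg, ← hg, this, map_smul,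
            smul_eq_mul, sub_self] }
    obtain ⟨s, hs⟩ := hφ g'
    refine ⟨s, fun x => ?_⟩
    obtain ⟨x, rfl⟩ := Submodule.Quotient.mk_surjective _ x
    rw [← hh, ← hf2', hρ, ← Submodule.Quotient.mk_smul, hΦ, hcmS, ← hs]
    congr 1
    change f2 x = g (cm x)
    rw [← sub_eq_zero]
    apply hnzd
    rw [mul_sub, ← hg, hcm, map_smul, smul_eq_mul, sub_self]

/-- Frobenius-type condition -/
structure Frob (A S : Type*) [CommRing A] [CommRing S] [Algebra A S] (J : Ideal S) : Prop where
  fin : Module.Finite A (S ⧸ J)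
  proj : Module.Projective A (S ⧸ J)
  cyc : CycDual A S (S ⧸ J)

section
variable {S : Type u} [CommRing S]

/-- the image of `I` in `S/J` for `J ≤ I`. -/
lemma proj_subquot (A : Type u) [CommRing A] [Algebra A S] {I J : Ideal S} (hJI : J ≤ I)
    [Module.Projective A (S ⧸ I)] :
    Module.Projective A ((S ⧸ J) ⧸ (Submodule.map (Submodule.mkQ J) I)) :=
  Module.Projective.of_equiv'
    ((Submodule.quotientQuotientEquivQuotient J I hJI).restrictScalars A).symm

/-- second isomorphism theorem -/
lemma exists_subquot_equiv (I I' : Ideal S) :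
    Nonempty ((Submodule.map (Submodule.mkQ (I ⊓ I')) I) ≃ₗ[S]
      (Submodule.map (Submodule.mkQ I') (I ⊔ I'))) := by
  let f : (S ⧸ (I ⊓ I')) →ₗ[S] (S ⧸ I') := Submodule.mapQ (I ⊓ I') I' LinearMap.id inf_le_right
  have hf : ∀ x : S, f (Submodule.Quotient.mk x) = Submodule.Quotient.mk x := fun x => rfl
  let g := f.restrict (p := Submodule.map (Submodule.mkQ (I ⊓ I')) I)
    (q := Submodule.map (Submodule.mkQ I') (I ⊔ I')) (by
      rintro _ ⟨x, hx, rfl⟩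
      exact ⟨x, (le_sup_left : I ≤ I ⊔ I') hx, rfl⟩)
  refine ⟨LinearEquiv.ofBijective g ⟨?_, ?_⟩⟩
  · rw [← LinearMap.ker_eq_bot, LinearMap.ker_eq_bot']
    rintro ⟨_, ⟨x, hx, rfl⟩⟩ h
    apply Subtype.ext
    have h' : (Submodule.Quotient.mk x : S ⧸ I') = 0 := congrArg Subtype.val h
    rw [Submodule.Quotient.mk_eq_zero] at h'
    exact (Submodule.Quotient.mk_eq_zero _).2 ⟨hx, h'⟩
  · rintro ⟨_, ⟨x, hx, rfl⟩⟩
    obtain ⟨y, hy, z, hz, rfl⟩ := Submodule.mem_sup.1 hx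
    refine ⟨⟨Submodule.Quotient.mk y, y, hy, rfl⟩, ?_⟩
    apply Subtype.ext
    change (Submodule.Quotient.mk y : S ⧸ I') = Submodule.Quotient.mk (y + z)
    rw [Submodule.Quotient.eq]
    simpa using hz

/-- (α) -/
lemma alpha {B A : Type u} [CommRing B] [CommRing A] [Algebra B A]
    [Algebra A S] [Algebra B S] [IsScalarTower B A S]
    {θ : A} (hθ : IsPolyExt B A θ) {d : ℕ} (hd : GD B d) (I I' : Ideal S)
    (hJ : Frob A S (I ⊓ I')) (hI : Module.Projective A (S ⧸ I))
    (hI' : Module.Projective A (S ⧸ I')) (hfin : Module.Finite B (S ⧸ (I ⊔ I'))) :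
    Frob B S (I ⊔ I') := by
  haveI := hJ.proj
  haveI := proj_subquot A (inf_le_left : I ⊓ I' ≤ I)
  have h1 := CycDual.sub (A := A) (Submodule.map (Submodule.mkQ (I ⊓ I')) I) hJ.cyc
  haveI h2 := projective_sub (A := A) (Submodule.map (Submodule.mkQ (I ⊓ I')) I)
  obtain ⟨e⟩ := exists_subquot_equiv I I'
  haveI h3 : Module.Projective A (Submodule.map (Submodule.mkQ I') (I ⊔ I')) :=
    Module.Projective.of_equiv' (e.restrictScalars A)
  have h4 := h1.of_equiv e
  let e2 := Submodule.quotientQuotientEquivQuotient I' (I ⊔ I') le_sup_right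
  haveI : Module.Finite B ((S ⧸ I') ⧸ Submodule.map (Submodule.mkQ I') (I ⊔ I')) :=
    Module.Finite.equiv (e2.restrictScalars B).symm
  obtain ⟨h5, h6⟩ := alpha' hθ hd (Submodule.map (Submodule.mkQ I') (I ⊔ I')) h4
  exact ⟨hfin, Module.Projective.of_equiv' (e2.restrictScalars B), h6.of_equiv e2⟩

/-- (β) -/
lemma beta {A : Type u} [CommRing A] [Algebra A S] (I I' : Ideal S) [hp : I.IsPrime]
    (hJ : Frob A S (I ⊓ I')) (hI' : Module.Projective A (S ⧸ I')) (hn : ¬ I' ≤ I) :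
    Module.Projective A (S ⧸ I) := by
  haveI := hJ.proj
  haveI := hJ.fin
  haveI := proj_subquot A (inf_le_right : I ⊓ I' ≤ I')
  set N := Submodule.map (Submodule.mkQ (I ⊓ I')) I' with hN
  obtain ⟨φ, hφ⟩ := CycDual.sub (A := A) N hJ.cyc
  haveI h2 := projective_sub (A := A) N
  haveI h3 : Module.Finite A N := by
    obtain ⟨r, hr⟩ := exists_retraction (A := A) N
    exact Module.Finite.of_surjective r (fun n => ⟨n, hr n⟩)
  let Ψ : S →ₗ[A] Module.Dual A N :=
    { toFun := fun s => φ.comp ((Algebra.lsmul A A N s))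
      map_add' := fun a b => by ext x; simp
      map_smul' := fun a b => by ext x; simp }
  have hΨ : ∀ s x, Ψ s x = φ (s • x) := fun _ _ => rfl
  have hsurj : Function.Surjective Ψ := by
    intro ψ
    obtain ⟨s, hs⟩ := hφ ψ
    exact ⟨s, by ext x; rw [hΨ, hs]⟩
  have hker : LinearMap.ker Ψ = I.restrictScalars A := by
    ext s
    rw [LinearMap.mem_ker, Submodule.restrictScalars_mem]
    constructor
    · intro h
      have h0 : ∀ x : N, s • x = 0 := by
        intro x
        by_contra hx
        obtain ⟨ψ, hψ⟩ := Module.Projective.exists_dual_ne_zero A hx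
        obtain ⟨t, ht⟩ := hφ ψ
        apply hψ
        rw [ht, smul_comm, ← hΨ, h, LinearMap.zero_apply]
      obtain ⟨y, hy, hyI⟩ := Set.not_subset.1 hn
      have h1 := congrArg Subtype.val (h0 ⟨Submodule.Quotient.mk y, y, hy, rfl⟩)
      have h2 : (Submodule.Quotient.mk (s * y) : S ⧸ (I ⊓ I')) = 0 := h1
      rw [Submodule.Quotient.mk_eq_zero] at h2
      exact (hp.mem_or_mem h2.1).resolve_right hyI
    · intro hs
      ext ⟨_, ⟨y, hy, rfl⟩⟩
      rw [hΨ, LinearMap.zero_apply]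
      convert map_zero φ
      apply Subtype.ext
      exact (Submodule.Quotient.mk_eq_zero _).2
        ⟨I.mul_mem_right _ hs, I'.mul_mem_left _ hy⟩
  have e := (Ψ.quotKerEquivOfSurjective hsurj).symm.trans (Submodule.quotEquivOfEq _ _ hker)
  exact Module.Projective.of_equiv' (e.trans (Submodule.Quotient.restrictScalarsEquiv A I))

end

end HK

namespace HK

open scoped TensorProduct Pointwise

lemma syz_resolution {R : Type u} [CommRing R] (P : ℕ → Type u) [∀ i, AddCommGroup (P i)]
    [∀ i, Module R (P i)] (d : ∀ i, P (i + 1) →ₗ[R] P i) (hP : ∀ i, Module.Projective R (P i))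
    (hd : ∀ i, Function.Exact (d (i + 1)) (d i)) (i : ℕ) :
    Syz R i (P i ⧸ LinearMap.range (d i)) := by
  induction i with
  | zero => trivial
  | succ i ih =>
    haveI := hP i
    have hker : LinearMap.ker (d i) = LinearMap.range (d (i + 1)) := (hd i).linearMap_ker_eq
    refine Syz.of_exact i (Submodule.liftQ (LinearMap.range (d (i + 1))) (d i) hker.ge)
      (LinearMap.range (d i)).mkQ ?_ (Submodule.mkQ_surjective _) ?_ ih
    · rw [← LinearMap.ker_eq_bot, Submodule.ker_liftQ_eq_bot]
      exact hker.le
    · rw [LinearMap.exact_iff, Submodule.ker_mkQ, Submodule.range_liftQ]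

lemma gor_core {R A : Type u} [CommRing R] [CommRing A] [Algebra A R] [Module.Projective A R]
    {n : ℕ} (hA : GD A n) (φ : R →ₗ[A] A)
    (h2 : ∀ ψ : R →ₗ[A] A, ∃ r : R, ∀ a, ψ a = φ (a • r))
    (h3 : ∀ r : R, (∀ a : R, φ (a • r) = 0) → r = 0)
    (P : ℕ → Type u) [∀ i, AddCommGroup (P i)]
    [∀ i, Module R (P i)] (d : ∀ i, P (i + 1) →ₗ[R] P i) (hP : ∀ i, Module.Projective R (P i))
    (hd : ∀ i, Function.Exact (d (i + 1)) (d i)) (i : ℕ) (hi : n ≤ i)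
    (h : P (i + 1) →ₗ[R] R) (hh : ∀ x, h (d (i + 1) x) = 0) :
    ∃ h' : P i →ₗ[R] R, ∀ x, h' (d i x) = h x := by
  letI : Module A (P i) := Module.compHom (P i) (algebraMap A R)
  haveI : IsScalarTower A R (P i) := IsScalarTower.of_algebraMap_smul (fun _ _ => rfl)
  haveI : Module.Projective A (P i ⧸ LinearMap.range (d i)) :=
    hA _ (Syz.mono hi (Syz.restrict i _ (syz_resolution P d hP hd i)))
  obtain ⟨r, hr⟩ := exists_retraction (A := A) (LinearMap.range (d i))
  have hker : LinearMap.ker (d i) = LinearMap.range (d (i + 1)) := (hd i).linearMap_ker_eq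
  have hle : LinearMap.ker (d i) ≤ LinearMap.ker h := by
    rw [hker]
    rintro _ ⟨x, rfl⟩
    exact hh x
  let h1 : LinearMap.range (d i) →ₗ[R] R :=
    (Submodule.liftQ _ h hle).comp (d i).quotKerEquivRange.symm.toLinearMap
  have hh1 : ∀ x, h1 ⟨d i x, x, rfl⟩ = h x := by
    intro x
    have : (d i).quotKerEquivRange (Submodule.Quotient.mk x) = ⟨d i x, x, rfl⟩ :=
      Subtype.ext rfl
    change (Submodule.liftQ _ h hle) ((d i).quotKerEquivRange.symm _) = _
    rw [← this, LinearEquiv.symm_apply_apply, Submodule.liftQ_apply]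
  obtain ⟨h', hh'⟩ := perfect_lift (B := A) (A := R) (R := R) (M := P i) ⊥ φ
    (fun ψ _ => h2 ψ) h3 (by simp) (φ.comp ((h1.restrictScalars A).comp r))
  refine ⟨h', fun x => ?_⟩
  rw [← sub_eq_zero]
  apply h3
  intro a
  have e1 : a • (h' (d i x) - h x) = h' (d i (a • x)) - h (a • x) := by
    simp only [map_smul, smul_sub]
  rw [e1, map_sub, hh']
  have e2 := hr ⟨d i (a • x), a • x, rfl⟩
  simp only [LinearMap.comp_apply, LinearMap.restrictScalars_apply]
  rw [e2, hh1, sub_self]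

open CategoryTheory in
lemma gor_ext {R : Type u} [CommRing R] (n : ℕ)
    (H : ∀ (P : ℕ → Type u) [∀ i, AddCommGroup (P i)] [∀ i, Module R (P i)]
      (d : ∀ i, P (i + 1) →ₗ[R] P i), (∀ i, Module.Projective R (P i)) →
      (∀ i, Function.Exact (d (i + 1)) (d i)) → ∀ i, n ≤ i → 
      ∀ (h : P (i + 1) →ₗ[R] R), (∀ x, h (d (i + 1) x) = 0) →
      ∃ h' : P i →ₗ[R] R, ∀ x, h' (d i x) = h x)
    (M : ModuleCat.{u} R) (i : ℕ) (hi : n < i) :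
    Subsingleton (((Ext R (ModuleCat.{u} R) i).obj (Opposite.op M)).obj (ModuleCat.of R R)) := by
  obtain ⟨j, rfl⟩ : ∃ j, i = j + 1 := ⟨i - 1, by omega⟩
  let Q := projectiveResolution M
  apply ModuleCat.subsingleton_of_isZero
  refine Limits.IsZero.of_iso ?_ (Q.isoExt (R := R) (j + 1) (ModuleCat.of R R))
  rw [← HomologicalComplex.exactAt_iff_isZero_homology,
    HomologicalComplex.exactAt_iff' _ j (j + 1) (j + 2) (by simp) (by simp),
    ShortComplex.moduleCat_exact_iff]
  intro (f : Q.complex.X (j + 1) ⟶ ModuleCat.of R R) hf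
  have hf' : Q.complex.d (j + 2) (j + 1) ≫ f = 0 := hf
  obtain ⟨h', hh'⟩ := H (fun i => Q.complex.X i) (fun i => (Q.complex.d (i + 1) i).hom)
    (fun i => (IsProjective.iff_projective _).2 (Q.projective i)) (fun i => by
      have := Q.exact_succ i
      rw [ShortComplex.ShortExact.moduleCat_exact_iff_function_exact] at this
      exact this) j (by omega) f.hom
      (fun x => by
        have := congrArg (fun g => g.hom x) hf'
        simpa using this)
  refine ⟨(ModuleCat.ofHom h' : Q.complex.X j ⟶ ModuleCat.of R R), ?_⟩
  change Q.complex.d (j + 1) j ≫ ModuleCat.ofHom h' = f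
  ext x
  exact hh' x

lemma Frob.gorenstein {A S : Type u} [CommRing A] [CommRing S] [Algebra A S] {J : Ideal S}
    (h : Frob A S J) {n : ℕ} (hA : GD A n) [IsNoetherianRing S] : IsGorensteinRing (S ⧸ J) := by
  refine ⟨inferInstance, n, fun M i hi => gor_ext n ?_ M i hi⟩
  intro P _ _ d hP hd i hi f hf
  haveI := h.proj
  obtain ⟨φ, hφ⟩ := h.cyc
  refine gor_core hA φ ?_ ?_ P d hP hd i hi f hf
  · intro ψ
    obtain ⟨s, hs⟩ := hφ ψ
    refine ⟨Ideal.Quotient.mk J s, fun a => ?_⟩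
    rw [hs, smul_eq_mul, mul_comm]
    rfl
  · intro r hr
    by_contra h0
    obtain ⟨ψ, hψ⟩ := Module.Projective.exists_dual_ne_zero A h0
    obtain ⟨s, hs⟩ := hφ ψ
    apply hψ
    rw [hs, ← hr (Ideal.Quotient.mk J s)]
    rfl

/-- base case: principal ideals -/
lemma frob_principal {B S : Type u} [CommRing B] [CommRing S] [IsDomain S] [Algebra B S] {θ : S}
    (hθ : IsPolyExt B S θ) {d : ℕ} (hd : GD B d) (f : S) (hf : f ≠ 0)
    (hfin : Module.Finite B (S ⧸ Ideal.span {f})) : Frob B S (Ideal.span {f}) := by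
  let e : S ≃ₗ[S] (Ideal.span {f} : Submodule S S) :=
    LinearEquiv.toSpanNonzeroSingleton S S f hf
  haveI : Module.Projective S (Ideal.span {f} : Submodule S S) := Module.Projective.of_equiv' e
  have hc : CycDual S S S := ⟨LinearMap.id, fun ψ => ⟨ψ 1, fun x => by
    have := ψ.map_smul x 1
    simpa [mul_comm] using this⟩⟩
  obtain ⟨h1, h2⟩ := alpha' (F := S) hθ hd (Ideal.span {f} : Submodule S S) (hc.of_equiv e)
  exact ⟨hfin, h1, h2⟩

end HK

namespace HK

open MvPolynomial

section
variable {K : Type u} [Field K] {n : ℕ}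

/-- variables indexed by natural numbers -/
noncomputable def xv (K : Type u) [Field K] (n : ℕ) (k : ℕ) : MvPolynomial (Fin n) K :=
  if h : k < n then X ⟨k, h⟩ else 0

lemma xv_of_lt {k : ℕ} (h : k < n) : xv K n k = X ⟨k, h⟩ := dif_pos h

/-- weights of monomials -/
def wt (d : Fin n →₀ ℕ) : ℕ := ∑ i, d i * (i : ℕ) ^ 2

lemma wt_add (d e : Fin n →₀ ℕ) : wt (d + e) = wt d + wt e := by
  simp [wt, add_mul, Finset.sum_add_distrib]

lemma wt_single (i : Fin n) : wt (Finsupp.single i 1) = (i : ℕ) ^ 2 := by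
  rw [wt, Finset.sum_eq_single i]
  · simp
  · intro j _ hj
    simp [Finsupp.single_eq_of_ne hj]
  · simp

lemma wt_sum {ι : Type*} (s : Finset ι) (f : ι → Fin n →₀ ℕ) :
    wt (∑ i ∈ s, f i) = ∑ i ∈ s, wt (f i) := by
  classical
  induction s using Finset.induction_on with
  | empty => simp [wt]
  | insert a s ha ih => rw [Finset.sum_insert ha, Finset.sum_insert ha, wt_add, ih]

/-- all monomials have weight less than `w` -/
def Lo (w : ℕ) (f : MvPolynomial (Fin n) K) : Prop := ∀ d, coeff d f ≠ 0 → wt d < w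

lemma Lo.zero (w : ℕ) : Lo w (0 : MvPolynomial (Fin n) K) := fun d h => by simp at h

lemma Lo.mono {w w' : ℕ} (h : w ≤ w') {f : MvPolynomial (Fin n) K} (hf : Lo w f) : Lo w' f :=
  fun d hd => (hf d hd).trans_le h

lemma Lo.add {w : ℕ} {f g : MvPolynomial (Fin n) K} (hf : Lo w f) (hg : Lo w g) :
    Lo w (f + g) := by
  intro d hd
  rw [coeff_add] at hd
  by_cases h : coeff d f = 0
  · exact hg d (by simpa [h] using hd)
  · exact hf d h

lemma Lo.C_mul {w : ℕ} {f : MvPolynomial (Fin n) K} (c : K) (hf : Lo w f) : Lo w (C c * f) := by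
  intro d hd
  rw [coeff_C_mul] at hd
  exact hf d (right_ne_zero_of_mul hd)

lemma Lo.sum {ι : Type*} {w : ℕ} (s : Finset ι) (f : ι → MvPolynomial (Fin n) K)
    (hf : ∀ i ∈ s, Lo w (f i)) : Lo w (∑ i ∈ s, f i) := by
  classical
  induction s using Finset.induction_on with
  | empty => simpa using Lo.zero w
  | insert a s ha ih =>
    rw [Finset.sum_insert ha]
    exact (hf a (by simp)).add (ih fun i hi => hf i (by simp [hi]))

lemma Lo.monomial {w : ℕ} (d : Fin n →₀ ℕ) (c : K) (h : wt d < w) :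
    Lo w (monomial d c) := by
  classical
  intro e he
  rw [coeff_monomial] at he
  split_ifs at he with h1
  · exact h1 ▸ h
  · exact absurd rfl he

lemma Lo.monomial_mul {w : ℕ} {f : MvPolynomial (Fin n) K} (d : Fin n →₀ ℕ) (hf : Lo w f) :
    Lo (wt d + w) (MvPolynomial.monomial d 1 * f) := by
  classical
  intro e he
  rw [coeff_monomial_mul'] at he
  split_ifs at he with h1
  · have := hf _ (by simpa using he)
    have h2 : wt e = wt d + wt (e - d) := by rw [← wt_add, add_tsub_cancel_of_le h1]
    omega
  · exact absurd rfl he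

/-- reduction -/
lemma reduce (G : Ideal (MvPolynomial (Fin n) K)) (Bad : (Fin n →₀ ℕ) → Prop)
    (hG : ∀ d, Bad d → ∃ g ∈ G, Lo (wt d) (monomial d 1 - g)) (w : ℕ) :
    ∀ f, Lo w f → ∃ h, f - h ∈ G ∧ Lo w h ∧ ∀ d, coeff d h ≠ 0 → ¬ Bad d := by
  classical
  induction w using Nat.strong_induction_on with
  | _ w ih =>
  intro f hf
  have key : ∀ d, ∃ h, wt d < w → (monomial d (1 : K) - h ∈ G ∧ Lo w h ∧
      ∀ e, coeff e h ≠ 0 → ¬ Bad e) := by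
    intro d
    by_cases hd : wt d < w
    swap
    · exact ⟨0, fun h => absurd h hd⟩
    by_cases hb : Bad d
    · obtain ⟨g, hg, hl⟩ := hG d hb
      obtain ⟨h, h1, h2, h3⟩ := ih (wt d) hd _ hl
      refine ⟨h, fun _ => ⟨?_, h2.mono hd.le, h3⟩⟩
      have := G.add_mem h1 hg
      convert this using 1
      ring
    · refine ⟨monomial d 1, fun _ => ⟨by simp, Lo.monomial d 1 hd, ?_⟩⟩
      intro e he
      rw [coeff_monomial] at he
      split_ifs at he with h1
      · exact h1 ▸ hb
      · exact absurd rfl he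
  choose h hh using key
  refine ⟨∑ d ∈ f.support, C (coeff d f) * h d, ?_, ?_, ?_⟩
  · have : f - ∑ d ∈ f.support, C (coeff d f) * h d =
        ∑ d ∈ f.support, C (coeff d f) * (monomial d 1 - h d) := by
      simp_rw [mul_sub, Finset.sum_sub_distrib, C_mul_monomial, mul_one]
      rw [← f.as_sum]
    rw [this]
    refine G.sum_mem fun d hd => G.mul_mem_left _ (hh d (hf d (mem_support_iff.1 hd))).1
  · exact Lo.sum _ _ fun d hd => ((hh d (hf d (mem_support_iff.1 hd))).2.1).C_mul _
  · intro e he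
    rw [coeff_sum] at he
    obtain ⟨d, hd, hde⟩ := Finset.exists_ne_zero_of_sum_ne_zero he
    rw [coeff_C_mul] at hde
    exact (hh d (hf d (mem_support_iff.1 hd))).2.2 e (right_ne_zero_of_mul hde)

lemma exists_Lo (f : MvPolynomial (Fin n) K) : ∃ w, Lo w f := by
  refine ⟨f.support.sup wt + 1, fun d hd => ?_⟩
  have := Finset.le_sup (f := wt) (mem_support_iff.2 hd)
  omega

/-- top monomials -/
lemma top_of_std (G q : Ideal (MvPolynomial (Fin n) K)) (Bad : (Fin n →₀ ℕ) → Prop)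
    (hG : ∀ d, Bad d → ∃ g ∈ G, Lo (wt d) (monomial d 1 - g)) (hGq : G ≤ q)
    (hq : ∀ f ∈ q, (∀ d, coeff d f ≠ 0 → ¬ Bad d) → f = 0)
    (f : MvPolynomial (Fin n) K) (hf : f ∈ q) (d : Fin n →₀ ℕ) (hd : coeff d f ≠ 0)
    (hmax : ∀ e, coeff e f ≠ 0 → wt e ≤ wt d) : Bad d := by
  classical
  by_contra hbad
  have key : ∀ e, ∃ g, Bad e → g ∈ G ∧ Lo (wt e) (monomial e (1 : K) - g) := by
    intro e
    by_cases hb : Bad e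
    · obtain ⟨g, hg⟩ := hG e hb
      exact ⟨g, fun _ => hg⟩
    · exact ⟨0, fun h => absurd h hb⟩
  choose g hg using key
  set F := ∑ e ∈ f.support with Bad e, C (coeff e f) * (monomial e 1 - g e) with hF
  have hFLo : Lo (wt d) F := by
    refine Lo.sum _ _ fun e he => Lo.C_mul _ ?_
    rw [Finset.mem_filter] at he
    exact (hg e he.2).2.mono (hmax e (mem_support_iff.1 he.1))
  obtain ⟨h, h1, h2, h3⟩ := reduce G Bad hG _ F hFLo
  set F1 := ∑ e ∈ f.support with ¬ Bad e, monomial e (coeff e f) with hF1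
  have hsplit : f - (F1 + h) ∈ G := by
    have e1 : f - (F1 + h) = (F - h) + ∑ e ∈ f.support with Bad e, C (coeff e f) * g e := by
      have e2 : F + ∑ e ∈ f.support with Bad e, C (coeff e f) * g e =
          ∑ e ∈ f.support with Bad e, monomial e (coeff e f) := by
        rw [hF, ← Finset.sum_add_distrib]
        refine Finset.sum_congr rfl fun e _ => ?_
        rw [mul_sub, C_mul_monomial, mul_one, sub_add_cancel]
      have e3 : F1 + ∑ e ∈ f.support with Bad e, monomial e (coeff e f) = f := by
        rw [hF1, add_comm, Finset.sum_filter_add_sum_filter_not, ← f.as_sum]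
      rw [← e2] at e3
      nth_rewrite 1 [← e3]
      ring
    rw [e1]
    refine G.add_mem h1 (G.sum_mem fun e he => G.mul_mem_left _ (hg e ?_).1)
    exact (Finset.mem_filter.1 he).2
  have hcF1 : ∀ e, coeff e F1 ≠ 0 → ¬ Bad e := by
    intro e he
    rw [hF1, coeff_sum] at he
    obtain ⟨e', he', h4⟩ := Finset.exists_ne_zero_of_sum_ne_zero he
    rw [coeff_monomial] at h4
    split_ifs at h4 with h5
    · exact h5 ▸ (Finset.mem_filter.1 he').2
    · exact absurd rfl h4
  have hz := hq (F1 + h) (by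
      have := q.sub_mem hf (hGq hsplit)
      simpa using this) (by
    intro e he
    rw [coeff_add] at he
    by_cases h4 : coeff e F1 = 0
    · exact h3 e (by simpa [h4] using he)
    · exact hcF1 e h4)
  have hc := congrArg (coeff d) hz
  rw [coeff_add, coeff_zero] at hc
  have hch : coeff d h = 0 := by
    by_contra h4
    exact lt_irrefl _ (h2 d h4)
  have hcd : coeff d F1 = coeff d f := by
    rw [hF1, coeff_sum, Finset.sum_eq_single d]
    · simp
    · intro e _ hed
      rw [coeff_monomial, if_neg hed]
    · intro h4
      exact absurd (Finset.mem_filter.2 ⟨mem_support_iff.2 hd, hbad⟩) h4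
  rw [hch, hcd, add_zero] at hc
  exact hd hc

/-- chains -/
def IsChain2 (s a b : ℕ) (c : ℕ → ℕ) : Prop :=
  (∀ k < s, a ≤ c k ∧ c k < b) ∧ ∀ k, k + 1 < s → c k + 2 ≤ c (k + 1)

/-- chains in a set -/
def HasChain (U : ℕ → Prop) (a b s : ℕ) : Prop :=
  ∃ c, IsChain2 s a b c ∧ ∀ k < s, U (c k)

lemma IsChain2.lt {s a b : ℕ} {c : ℕ → ℕ} (h : IsChain2 s a b c) {i j : ℕ} (hij : i < j)
    (hj : j < s) : c i + 2 ≤ c j := by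
  induction j, hij using Nat.le_induction with
  | base => exact h.2 i hj
  | succ j hij ih =>
    have := ih (by omega)
    have := h.2 j hj
    omega

/-- The minors. -/
noncomputable def DD (K : Type u) [Field K] (n s : ℕ) (c : ℕ → ℕ) : MvPolynomial (Fin n) K :=
  (Matrix.of fun i j : Fin s => xv K n (c i / 2 + (c j + 1) / 2)).det

/-- exponent of the leading monomial -/
noncomputable def lexp (n s : ℕ) (c : ℕ → ℕ) : Fin n →₀ ℕ :=
  ∑ i : Fin s, if h : c i < n then Finsupp.single ⟨c i, h⟩ 1 else 0

lemma DD_lead {s a b : ℕ} {c : ℕ → ℕ} (h : IsChain2 s a b c) (hb : b ≤ n) :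
    Lo (wt (lexp n s c)) (monomial (lexp n s c) 1 - DD K n s c) := by
  classical
  have hin : ∀ i j : Fin s, c i / 2 + (c j + 1) / 2 < n := by
    intro i j
    have := h.1 i i.2
    have := h.1 j j.2
    omega
  have hprod : ∀ σ : Equiv.Perm (Fin s), ∏ i, xv K n (c (σ i) / 2 + (c i + 1) / 2) =
      monomial (∑ i : Fin s, Finsupp.single (⟨c (σ i) / 2 + (c i + 1) / 2, hin (σ i) i⟩ : Fin n) 1)
        (1 : K) := by
    intro σ
    rw [monomial_sum_one]
    refine Finset.prod_congr rfl fun i _ => ?_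
    rw [xv_of_lt (hin _ _)]
    rfl
  have hw : ∀ σ : Equiv.Perm (Fin s), wt (∑ i : Fin s,
      Finsupp.single (⟨c (σ i) / 2 + (c i + 1) / 2, hin (σ i) i⟩ : Fin n) 1) =
      (∑ i : Fin s, (c i / 2) ^ 2 + ∑ i : Fin s, ((c i + 1) / 2) ^ 2) +
        2 * ∑ i : Fin s, (c (σ i) / 2) * ((c i + 1) / 2) := by
    intro σ
    rw [wt_sum]
    simp_rw [wt_single]
    rw [← Equiv.sum_comp σ (fun i : Fin s => (c i / 2) ^ 2), Finset.mul_sum,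
      ← Finset.sum_add_distrib, ← Finset.sum_add_distrib]
    refine Finset.sum_congr rfl fun i _ => ?_
    ring
  have hl : lexp n s c = ∑ i : Fin s,
      Finsupp.single (⟨c ((1 : Equiv.Perm (Fin s)) i) / 2 + (c i + 1) / 2, hin _ i⟩ : Fin n) 1 := by
    refine Finset.sum_congr rfl fun i _ => ?_
    have h1 : c i < n := by have := h.1 i i.2; omega
    rw [dif_pos h1]
    congr 1
    apply Fin.ext
    simp only [Equiv.Perm.coe_one, id_eq]
    omega
  have hdet : DD K n s c = ∑ σ : Equiv.Perm (Fin s), C ((Equiv.Perm.sign σ : ℤ) : K) *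
      ∏ i, xv K n (c (σ i) / 2 + (c i + 1) / 2) := by
    rw [DD, Matrix.det_apply']
    refine Finset.sum_congr rfl fun σ _ => ?_
    simp
  rw [hdet, ← Finset.add_sum_erase _ _ (Finset.mem_univ (1 : Equiv.Perm (Fin s))), hprod 1, ← hl]
  simp only [Equiv.Perm.sign_one, Units.val_one, Int.cast_one, C_1, one_mul]
  rw [sub_add_eq_sub_sub, sub_self, zero_sub, ← neg_one_mul, ← C_1, ← C_neg]
  refine Lo.C_mul _ (Lo.sum _ _ fun σ hσ => Lo.C_mul _ ?_)
  rw [hprod σ]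
  apply Lo.monomial
  rw [hl, hw, hw]
  have hmp : StrictMono fun i : Fin s => c i / 2 := by
    intro i j hij
    have := h.lt hij j.2
    dsimp only
    omega
  have hmg : StrictMono fun i : Fin s => (c i + 1) / 2 := by
    intro i j hij
    have := h.lt hij j.2
    dsimp only
    omega
  have hmon : Monovary (fun i : Fin s => c i / 2) (fun i : Fin s => (c i + 1) / 2) :=
    hmp.monotone.monovary hmg.monotone
  have := (hmon.sum_comp_perm_mul_lt_sum_mul_iff (σ := σ)).2 (by
    intro hm
    apply (Finset.mem_erase.1 hσ).1
    have h1 : StrictMono σ := by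
      refine Monotone.strictMono_of_injective ?_ σ.injective
      intro i j hij
      rcases hij.lt_or_eq with hij | rfl
      · exact hmp.le_iff_le.1 (hm (hmg hij))
      · exact le_rfl
    have h2 := (h1.range_inj strictMono_id).1 (by simp)
    ext i
    simp [h2])
  have e1 : ∀ i : Fin s, (1 : Equiv.Perm (Fin s)) i = i := fun _ => rfl
  simp only [e1]
  omega

/-- membership of an index in the support -/
def sp (d : Fin n →₀ ℕ) (k : ℕ) : Prop := ∃ i : Fin n, (i : ℕ) = k ∧ d i ≠ 0

/-- nonstandard monomials -/
def Bad (a b s : ℕ) (d : Fin n →₀ ℕ) : Prop := HasChain (sp d) a b s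

lemma lexp_apply {s a b : ℕ} {c : ℕ → ℕ} (h : IsChain2 s a b c) (i : Fin n) :
    lexp n s c i = if ∃ k < s, c k = i then 1 else 0 := by
  classical
  have hterm : ∀ k : Fin s, (if h : c k < n then Finsupp.single (⟨c k, h⟩ : Fin n) 1 else 0) i =
      if c k = i then 1 else 0 := by
    intro k
    by_cases h1 : c k < n
    · rw [dif_pos h1, Finsupp.single_apply]
      congr 1
      simp [Fin.ext_iff]
    · rw [dif_neg h1, if_neg]
      · rfl
      · intro h2
        exact h1 (h2 ▸ i.2)
  rw [lexp, Finsupp.finsetSum_apply]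
  simp_rw [hterm]
  split_ifs with hk
  · obtain ⟨k, hk, hck⟩ := hk
    rw [Finset.sum_eq_single ⟨k, hk⟩]
    · simp [hck]
    · intro j _ hj
      rw [if_neg]
      intro h2
      rcases lt_trichotomy (j : ℕ) k with h3 | h3 | h3
      · have := h.lt h3 hk
        omega
      · exact hj (Fin.ext h3)
      · have := h.lt h3 j.2
        omega
    · simp
  · refine Finset.sum_eq_zero fun k _ => ?_
    rw [if_neg]
    exact fun h2 => hk ⟨k, k.2, h2⟩

lemma sp_lexp {s a b : ℕ} {c : ℕ → ℕ} (h : IsChain2 s a b c) (k : ℕ) (hk : sp (lexp n s c) k) :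
    ∃ j < s, c j = k := by
  obtain ⟨i, rfl, hi⟩ := hk
  rw [lexp_apply h] at hi
  by_contra h1
  exact hi (if_neg h1)

lemma bad_step {a b s : ℕ} (hb : b ≤ n) (d : Fin n →₀ ℕ) (hd : Bad a b s d) :
    ∃ c, IsChain2 s a b c ∧ ∃ g : MvPolynomial (Fin n) K, 
      Lo (wt d) (monomial d 1 - g * DD K n s c) := by
  obtain ⟨c, hc, hU⟩ := hd
  refine ⟨c, hc, monomial (d - lexp n s c) 1, ?_⟩
  have hle : lexp n s c ≤ d := by
    intro i
    rw [lexp_apply hc]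
    split_ifs with hk
    · obtain ⟨k, hk, hck⟩ := hk
      obtain ⟨j, hj, hdj⟩ := hU k hk
      have : j = i := Fin.ext (hj.trans hck)
      subst this
      omega
    · exact Nat.zero_le _
  have hd' : d = (d - lexp n s c) + lexp n s c := (tsub_add_cancel_of_le hle).symm
  have e : monomial d (1 : K) - monomial (d - lexp n s c) 1 * DD K n s c =
      monomial (d - lexp n s c) 1 * (monomial (lexp n s c) 1 - DD K n s c) := by
    rw [mul_sub, monomial_mul, ← hd', one_mul]
  rw [e]
  have := (DD_lead (K := K) hc hb).monomial_mul (d - lexp n s c)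
  rwa [← wt_add, ← hd'] at this

end

end HK

namespace HK

open MvPolynomial

section
variable {K : Type u} [Field K] {n : ℕ}

/-- parametrized points -/
def ZZ (K : Type u) [Field K] (n a b r : ℕ) : Set (Fin n → AlgebraicClosure K) :=
  {z | ∃ α v : Fin r → AlgebraicClosure K, ∀ i : Fin n, a ≤ (i : ℕ) → (i : ℕ) < b →
    z i = ∑ j, α j * v j ^ ((i : ℕ) - a)}

/-- The Hankel ideals -/
noncomputable def qq (K : Type u) [Field K] (n a b : ℕ) : ℕ → Ideal (MvPolynomial (Fin n) K)
  | 0 => ⊤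
  | r + 1 => ⨅ z ∈ ZZ K n a b r, RingHom.ker (aeval z : MvPolynomial (Fin n) K →ₐ[K] _)

lemma qq_zero (a b : ℕ) : qq K n a b 0 = ⊤ := rfl

lemma mem_qq_succ {a b r : ℕ} {f : MvPolynomial (Fin n) K} :
    f ∈ qq K n a b (r + 1) ↔ ∀ z ∈ ZZ K n a b r, aeval z f = 0 := by
  simp [qq, Submodule.mem_iInf, RingHom.mem_ker]

lemma qq_prime (a b r : ℕ) : (qq K n a b (r + 1)).IsPrime := by
  let L := AlgebraicClosure K
  let Φ : MvPolynomial (Fin n) K →ₐ[K] MvPolynomial ((Fin r ⊕ Fin r) ⊕ Fin n) L :=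
    aeval (fun i : Fin n => if a ≤ (i : ℕ) ∧ (i : ℕ) < b then
      ∑ j, X (Sum.inl (Sum.inl j)) * X (Sum.inl (Sum.inr j)) ^ ((i : ℕ) - a) else X (Sum.inr i))
  have h : qq K n a b (r + 1) = RingHom.ker Φ := by
    ext f
    rw [mem_qq_succ, RingHom.mem_ker]
    have hev : ∀ p : (Fin r ⊕ Fin r) ⊕ Fin n → L, eval p (Φ f) = aeval (fun i : Fin n =>
        if a ≤ (i : ℕ) ∧ (i : ℕ) < b then
        ∑ j, p (Sum.inl (Sum.inl j)) * p (Sum.inl (Sum.inr j)) ^ ((i : ℕ) - a)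
        else p (Sum.inr i)) f := by
      intro p
      have h1 := comp_aeval_apply (R := K) (fun i : Fin n => if a ≤ (i : ℕ) ∧ (i : ℕ) < b then
        ∑ j, X (Sum.inl (Sum.inl j)) * X (Sum.inl (Sum.inr j)) ^ ((i : ℕ) - a) 
          else (X (Sum.inr i) : MvPolynomial ((Fin r ⊕ Fin r) ⊕ Fin n) L)) 
          ((aeval p : MvPolynomial ((Fin r ⊕ Fin r) ⊕ Fin n) L →ₐ[L] L).restrictScalars K) f
      rw [← coe_aeval_eq_eval]
      refine h1.trans ?_
      congr 2
      ext i
      split_ifs <;> simp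
    constructor
    · intro hz
      apply MvPolynomial.funext
      intro p
      rw [hev, map_zero]
      apply hz
      refine ⟨fun j => p (Sum.inl (Sum.inl j)), fun j => p (Sum.inl (Sum.inr j)), ?_⟩
      intro i h1 h2
      exact if_pos ⟨h1, h2⟩
    · rintro hΦ z ⟨α, v, hz⟩
      have := hev (Sum.elim (Sum.elim α v) z)
      rw [hΦ, map_zero] at this
      rw [this]
      congr 2
      ext i
      split_ifs with hi
      · rw [hz i hi.1 hi.2]
        rfl
      · rfl
  rw [h]
  exact RingHom.ker_isPrime _

lemma det_mul_zero {L : Type*} [Field L] {r : ℕ} (A : Matrix (Fin (r + 1)) (Fin r) L)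
    (B : Matrix (Fin r) (Fin (r + 1)) L) : (A * B).det = 0 := by
  have h := LinearMap.ker_ne_bot_of_finrank_lt (f := B.mulVecLin) (by simp)
  obtain ⟨v, hv, hv0⟩ := Submodule.exists_mem_ne_zero_of_ne_bot h
  rw [← Matrix.exists_mulVec_eq_zero_iff]
  refine ⟨v, hv0, ?_⟩
  rw [LinearMap.mem_ker, Matrix.mulVecLin_apply] at hv
  rw [← Matrix.mulVec_mulVec, hv, Matrix.mulVec_zero]

lemma det_mem_qq {a b s : ℕ} (hb : b ≤ n) (ρ γ : Fin s → ℕ)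
    (h : ∀ i j, a ≤ ρ i + γ j ∧ ρ i + γ j < b) :
    (Matrix.of fun i j : Fin s => xv K n (ρ i + γ j)).det ∈ qq K n a b s := by
  cases s with
  | zero => exact Submodule.mem_top
  | succ r =>
    rw [mem_qq_succ]
    rintro z ⟨α, v, hz⟩
    obtain ⟨i0, -, hi0⟩ := Finset.exists_min_image Finset.univ ρ Finset.univ_nonempty
    have : (aeval z) ((Matrix.of fun i j : Fin (r + 1) => xv K n (ρ i + γ j)).det) =
        ((Matrix.of fun (i : Fin (r + 1)) (k : Fin r) => α k * v k ^ (ρ i - ρ i0)) *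
        (Matrix.of fun (k : Fin r) (j : Fin (r + 1)) => v k ^ (ρ i0 + γ j - a))).det := by
      rw [AlgHom.map_det]
      congr 1
      ext i j
      have h1 := h i j
      have h2 := h i0 j
      have h3 := hi0 i (Finset.mem_univ _)
      rw [AlgHom.mapMatrix_apply, Matrix.map_apply, Matrix.of_apply,
        xv_of_lt (h1.2.trans_le hb), aeval_X, hz _ h1.1 h1.2, Matrix.mul_apply]
      refine Finset.sum_congr rfl fun k _ => ?_
      simp only [Matrix.of_apply]
      rw [mul_assoc, ← pow_add]
      congr 2
      omega
    rw [this, det_mul_zero]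

lemma DD_mem_qq {a b s : ℕ} (hb : b ≤ n) {c : ℕ → ℕ} (h : IsChain2 s a b c) :
    DD K n s c ∈ qq K n a b s := by
  apply det_mem_qq hb (fun i : Fin s => c i / 2) (fun j : Fin s => (c j + 1) / 2)
  intro i j
  have := h.1 i i.2
  have := h.1 j j.2
  omega

lemma bad_mono {a b a' b' s : ℕ} (ha : a ≤ a') (hb : b' ≤ b) {d : Fin n →₀ ℕ}
    (h : Bad a' b' s d) : Bad a b s d := by
  obtain ⟨c, hc, hU⟩ := h
  refine ⟨c, ⟨fun k hk => ?_, hc.2⟩, hU⟩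
  have := hc.1 k hk
  omega

/-- no indices involving a vanishing coordinate -/
lemma aeval_congr_of_not_mem {L : Type*} [Field L] [Algebra K L] (f : MvPolynomial (Fin n) K)
    (B : Fin n) (hB : ∀ d, coeff d f ≠ 0 → d B = 0) (z w : Fin n → L)
    (hzw : ∀ i, i ≠ B → z i = w i) : aeval z f = aeval w f := by
  rw [aeval_def, aeval_def, eval₂_eq', eval₂_eq']
  refine Finset.sum_congr rfl fun d hd => ?_
  congr 1
  refine Finset.prod_congr rfl fun i _ => ?_
  by_cases h : i = B
  · subst h
    rw [hB d (mem_support_iff.1 hd), pow_zero, pow_zero]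
  · rw [hzw i h]

/-- coefficient of the highest power -/
noncomputable def topc (f : MvPolynomial (Fin n) K) (B : Fin n) (J : ℕ) :
    MvPolynomial (Fin n) K :=
  ∑ d ∈ f.support with d B = J, monomial (d.erase B) (coeff d f)

lemma topc_coeff (f : MvPolynomial (Fin n) K) (B : Fin n) (J : ℕ) (d : Fin n →₀ ℕ)
    (hd : coeff d f ≠ 0) (hJ : d B = J) : coeff (d.erase B) (topc f B J) = coeff d f := by
  classical
  rw [topc, coeff_sum, Finset.sum_eq_single d]
  · simp
  · intro e he hed
    rw [coeff_monomial, if_neg]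
    intro h
    apply hed
    have h1 := (Finset.mem_filter.1 he).2
    rw [← Finsupp.single_add_erase B e, ← Finsupp.single_add_erase B d, h, h1, hJ]
  · intro h
    exact absurd (Finset.mem_filter.2 ⟨mem_support_iff.2 hd, hJ⟩) h

lemma topc_supp (f : MvPolynomial (Fin n) K) (B : Fin n) (J : ℕ) (e : Fin n →₀ ℕ)
    (he : coeff e (topc f B J) ≠ 0) : ∃ d, coeff d f ≠ 0 ∧ d B = J ∧ d.erase B = e := by
  classical
  rw [topc, coeff_sum] at he
  obtain ⟨d, hd, h⟩ := Finset.exists_ne_zero_of_sum_ne_zero he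
  rw [coeff_monomial] at h
  split_ifs at h with h1
  · exact ⟨d, mem_support_iff.1 (Finset.mem_filter.1 hd).1, (Finset.mem_filter.1 hd).2, h1⟩
  · exact absurd rfl h

/-- the specialization argument -/
lemma topc_vanish {L : Type*} [Field L] [Algebra K L] [Infinite L] (f : MvPolynomial (Fin n) K)
    (B : Fin n) (J : ℕ) (hJ : ∀ d, coeff d f ≠ 0 → d B ≤ J)
    (W : Fin n → Polynomial L) (β c0 : L)
    (hW : ∀ σ : L, σ ≠ 0 → σ ≠ - c0 → 
      aeval (fun i => if i = B then β + σ⁻¹ else (W i).eval σ) f = 0) :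
    aeval (fun i => (W i).eval 0) (topc f B J) = 0 := by
  classical
  let F : Polynomial L := ∑ d ∈ f.support, Polynomial.C (algebraMap K L (coeff d f)) *
    ((Polynomial.C β * Polynomial.X + 1) ^ (d B) * Polynomial.X ^ (J - d B) *
      ∏ i ∈ Finset.univ.erase B, W i ^ (d i))
  have hF : F = 0 := by
    apply Polynomial.eq_zero_of_infinite_isRoot
    refine Set.Infinite.mono (s := {0, -c0}ᶜ) ?_ (Set.Finite.infinite_compl (by simp))
    intro σ hσ
    simp only [Set.mem_compl_iff, Set.mem_insert_iff, Set.mem_singleton_iff, not_or] at hσ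
    have h1 := hW σ hσ.1 hσ.2
    rw [Set.mem_ofPred_eq, Polynomial.IsRoot.def]
    have h2 : F.eval σ = σ ^ J *
        aeval (fun i => if i = B then β + σ⁻¹ else (W i).eval σ) f := by
      rw [aeval_def, eval₂_eq', Finset.mul_sum, Polynomial.eval_finsetSum]
      refine Finset.sum_congr rfl fun d hd => ?_
      have hdJ := hJ d (mem_support_iff.1 hd)
      rw [← Finset.mul_prod_erase _ _ (Finset.mem_univ B), if_pos rfl]
      have h3 : ∏ i ∈ Finset.univ.erase B,
          (if i = B then β + σ⁻¹ else (W i).eval σ) ^ d i =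
          ∏ i ∈ Finset.univ.erase B, (W i).eval σ ^ d i :=
        Finset.prod_congr rfl fun i hi => by rw [if_neg (Finset.ne_of_mem_erase hi)]
      rw [h3]
      simp only [Polynomial.eval_mul, Polynomial.eval_C, Polynomial.eval_pow, Polynomial.eval_add,
        Polynomial.eval_X, Polynomial.eval_one, Polynomial.eval_prod]
      have h4 : (β * σ + 1) ^ d B * σ ^ (J - d B) = σ ^ J * (β + σ⁻¹) ^ d B := by
        have : β * σ + 1 = σ * (β + σ⁻¹) := by
          rw [mul_add, mul_inv_cancel₀ hσ.1, mul_comm]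
        rw [this, mul_pow, mul_right_comm, ← pow_add, Nat.add_sub_cancel' hdJ]
      rw [h4]
      ring
    rw [h2, h1, mul_zero]
  have h0 : F.eval 0 = 0 := by rw [hF, Polynomial.eval_zero]
  refine Eq.trans ?_ h0
  rw [topc, map_sum, Polynomial.eval_finsetSum, Finset.sum_filter]
  refine Finset.sum_congr rfl fun d hd => ?_
  have hdJ := hJ d (mem_support_iff.1 hd)
  simp only [Polynomial.eval_mul, Polynomial.eval_C, Polynomial.eval_pow, Polynomial.eval_add,
    Polynomial.eval_X, Polynomial.eval_one, Polynomial.eval_prod, mul_zero, zero_add, one_pow,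
    one_mul]
  split_ifs with h
  · rw [h, Nat.sub_self, pow_zero, one_mul, aeval_monomial, Finsupp.prod_fintype _ _ (by simp),
      ← Finset.mul_prod_erase _ _ (Finset.mem_univ B), Finsupp.erase_same, pow_zero, one_mul]
    congr 1
    refine Finset.prod_congr rfl fun i hi => ?_
    rw [Finsupp.erase_ne (Finset.ne_of_mem_erase hi)]
  · rw [zero_pow (by omega), zero_mul, mul_zero]

/-- (F2) -/
lemma std_eq_zero (a : ℕ) : ∀ (b s : ℕ), b ≤ n → ∀ f ∈ qq K n a b s,
    (∀ d, coeff d f ≠ 0 → ¬ Bad a b s d) → f = 0 := by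
  classical
  intro b
  induction b using Nat.strong_induction_on with
  | _ b ih =>
  intro s hb f hf hstd
  cases s with
  | zero =>
    by_contra h0
    obtain ⟨d, hd⟩ := MvPolynomial.exists_coeff_ne_zero h0
    exact hstd d hd ⟨fun _ => 0, ⟨by simp, by simp⟩, by simp⟩
  | succ r =>
  rw [mem_qq_succ] at hf
  by_cases hab : b ≤ a
  · have h1 : ∀ z : Fin n → AlgebraicClosure K, aeval z f = 0 := fun z => hf z ⟨0, 0, fun i h1 h2 => by omega⟩
    apply MvPolynomial.map_injective (algebraMap K (AlgebraicClosure K))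
      (algebraMap K (AlgebraicClosure K)).injective
    apply MvPolynomial.funext
    intro z
    rw [map_zero, map_zero, eval_map]
    exact h1 z
  push Not at hab
  let B : Fin n := ⟨b - 1, by omega⟩
  set J := f.support.sup (fun d => d B) with hJdef
  have hJ : ∀ d, coeff d f ≠ 0 → d B ≤ J := fun d hd =>
    Finset.le_sup (f := fun d : Fin n →₀ ℕ => d B) (mem_support_iff.2 hd)
  by_cases hJ0 : J = 0
  · have hB : ∀ d, coeff d f ≠ 0 → d B = 0 := fun d hd => by have := hJ d hd; omega
    refine ih (b - 1) (by omega) (r + 1) (by omega) f ?_ ?_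
    · rw [mem_qq_succ]
      rintro z ⟨α, v, hz⟩
      rw [aeval_congr_of_not_mem f B hB z
        (fun i => if i = B then ∑ j, α j * v j ^ ((i : ℕ) - a) else z i)]
      · apply hf
        refine ⟨α, v, fun i h1 h2 => ?_⟩
        dsimp only
        split_ifs with hi
        · rfl
        · apply hz i h1
          have : (i : ℕ) ≠ b - 1 := fun h => hi (Fin.ext h)
          omega
      · intro i hi
        rw [if_neg hi]
    · intro d hd hbad
      exact hstd d hd (bad_mono le_rfl (by omega) hbad)
  · exfalso
    have hne : f.support.Nonempty := by
      rw [Finset.nonempty_iff_ne_empty]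
      intro h
      apply hJ0
      rw [hJdef, h]
      rfl
    obtain ⟨d0, hd0, hd0J⟩ := Finset.exists_mem_eq_sup f.support hne (fun d => d B)
    rw [mem_support_iff] at hd0
    have hspB : ∀ d : Fin n →₀ ℕ, d B = J → sp d (b - 1) := fun d hd => ⟨B, rfl, by omega⟩
    cases r with
    | zero =>
      apply hstd d0 hd0
      refine ⟨fun _ => b - 1, ⟨fun k _ => by dsimp only; omega, fun k hk => by omega⟩, fun k _ =>
        hspB d0 hd0J.symm⟩
    | succ r =>
    have key : topc f B J = 0 := by
      refine ih (b - 2) (by omega) (r + 1) (by omega) _ ?_ ?_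
      · rw [mem_qq_succ]
        rintro z ⟨α, v, hz⟩
        let zt : Fin n → AlgebraicClosure K := fun i =>
          if a ≤ (i : ℕ) ∧ (i : ℕ) < b then ∑ j, α j * v j ^ ((i : ℕ) - a) else z i
        obtain ⟨c0, hc0⟩ : ∃ c0, ∀ i : Fin n, (i : ℕ) + 1 = b - 1 → zt i + c0 = z i := by
          by_cases h2 : 2 ≤ b
          · exact ⟨z ⟨b - 2, by omega⟩ - zt ⟨b - 2, by omega⟩, fun i hi => by
              have : i = ⟨b - 2, by omega⟩ := Fin.ext (by dsimp only; omega)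
              rw [this]
              ring⟩
          · exact ⟨0, fun i hi => by omega⟩
        let W : Fin n → Polynomial (AlgebraicClosure K) := fun i =>
          if a ≤ (i : ℕ) ∧ (i : ℕ) < b then Polynomial.C (zt i) +
            (Polynomial.C c0 + Polynomial.X) ^ (b - 1 - i) * Polynomial.X ^ (b - 1 - i - 1)
          else Polynomial.C (z i)
        have h1 := topc_vanish f B J hJ W (zt B) c0 ?_
        · rw [← h1]
          apply aeval_congr_of_not_mem _ B
          · intro e he
            obtain ⟨d, -, -, rfl⟩ := topc_supp f B J e he
            exact Finsupp.erase_same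
          · intro i hi
            have hi' : (i : ℕ) ≠ b - 1 := fun h => hi (Fin.ext h)
            simp only [W]
            split_ifs with h2
            · simp only [Polynomial.eval_add, Polynomial.eval_mul, Polynomial.eval_C,
                Polynomial.eval_pow, Polynomial.eval_X, add_zero]
              by_cases h3 : (i : ℕ) + 1 = b - 1
              · have h4 : b - 1 - (i : ℕ) = 1 := by omega
                rw [h4, pow_one, Nat.sub_self, pow_zero, mul_one, hc0 i h3]
              · rw [zero_pow (by omega), mul_zero, add_zero]
                simp only [zt]
                rw [if_pos h2]
                exact hz i h2.1 (by omega)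
            · simp
        · intro σ hσ hσc
          apply hf
          have hne : (c0 + σ) * σ ≠ 0 := mul_ne_zero (fun h => hσc (by linear_combination h)) hσ
          refine ⟨Fin.cons (σ⁻¹ * ((c0 + σ) * σ) ^ (b - 1 - a)) α,
            Fin.cons (((c0 + σ) * σ)⁻¹) v, fun i hi1 hi2 => ?_⟩
          rw [Fin.sum_univ_succ]
          simp only [Fin.cons_zero, Fin.cons_succ]
          have hzt : zt i = ∑ j, α j * v j ^ ((i : ℕ) - a) := if_pos ⟨hi1, hi2⟩
          rw [← hzt]
          have e1 : σ⁻¹ * ((c0 + σ) * σ) ^ (b - 1 - a) * ((c0 + σ) * σ)⁻¹ ^ ((i : ℕ) - a) =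
              σ⁻¹ * ((c0 + σ) * σ) ^ (b - 1 - i) := by
            have : b - 1 - a = (b - 1 - i) + (i - a) := by omega
            rw [this, pow_add, inv_pow, mul_assoc, mul_assoc, mul_inv_cancel₀ (pow_ne_zero _ hne),
              mul_one]
          rw [e1]
          split_ifs with hiB
          · subst hiB
            simp only [B, Nat.sub_self, pow_zero, mul_one]
            ring
          · have hi' : (i : ℕ) ≠ b - 1 := fun h => hiB (Fin.ext h)
            simp only [W]
            rw [if_pos ⟨hi1, hi2⟩]
            simp only [Polynomial.eval_add, Polynomial.eval_mul, Polynomial.eval_C,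
                Polynomial.eval_pow, Polynomial.eval_X]
            rw [add_comm]
            congr 1
            obtain ⟨k, hk⟩ : ∃ k, b - 1 - (i : ℕ) = k + 1 := ⟨b - 1 - i - 1, by omega⟩
            rw [hk, mul_pow, Nat.add_sub_cancel, pow_succ σ k]
            field_simp
      · intro e he hbad
        obtain ⟨d, hd, hdJ, rfl⟩ := topc_supp f B J e he
        obtain ⟨c, hc, hU⟩ := hbad
        apply hstd d hd
        refine ⟨fun k => if k < r + 1 then c k else b - 1, ⟨?_, ?_⟩, ?_⟩
        · intro k hk
          dsimp only
          split_ifs with h1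
          · have := hc.1 k h1
            omega
          · omega
        · intro k hk
          dsimp only
          split_ifs with h1 h2
          · exact hc.2 k h2
          · have := hc.1 k h1
            omega
          · omega
          · omega
        · intro k hk
          dsimp only
          split_ifs with h1
          · obtain ⟨i, hi, hdi⟩ := hU k h1
            refine ⟨i, hi, fun h => hdi ?_⟩
            by_cases hiB : i = B
            · subst hiB; exact Finsupp.erase_same
            · rw [Finsupp.erase_ne hiB, h]
          · exact hspB d hdJ
    have := topc_coeff f B J d0 hd0 hd0J.symm
    rw [key, coeff_zero] at this
    exact hd0 this.symm

end

end HK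

namespace HK

open MvPolynomial

lemma comb1 (U : ℕ → Prop) (a b s : ℕ) (hs : 1 ≤ s) (hb : b ≠ a + 2 * s)
    (hc : HasChain U a (b - 1) s) (hi : HasChain U (a + 1) b s) :
    HasChain U a b (s + 1) ∨ HasChain U (a + 1) (b - 1) s := by
  by_contra hcon
  push Not at hcon
  obtain ⟨N1, N2⟩ := hcon
  obtain ⟨c, hc, hcU⟩ := hc
  obtain ⟨i, hi, hiU⟩ := hi
  have hlow : ∀ k < s, c 0 ≤ c k := by
    intro k hk
    rcases Nat.eq_zero_or_pos k with rfl | h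
    · exact le_rfl
    · have := hc.lt h hk
      omega
  have hhigh : ∀ k < s, i k ≤ i (s - 1) := by
    intro k hk
    rcases eq_or_ne k (s - 1) with rfl | h
    · exact le_rfl
    · have := hi.lt (show k < s - 1 by omega) (by omega)
      omega
  have hc0 : c 0 = a := by
    by_contra h
    apply N2
    refine ⟨c, ⟨fun k hk => ?_, hc.2⟩, hcU⟩
    have := hc.1 k hk
    have := hc.1 0 (by omega)
    have := hlow k hk
    omega
  have A : ∀ k < s, i k < c k + 2 := by
    intro k hk
    by_contra h
    apply N1
    refine ⟨fun j => if j ≤ k then c j else i (j - 1), ⟨?_, ?_⟩, ?_⟩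
    · intro j hj
      dsimp only
      split_ifs with h1
      · have := hc.1 j (by omega)
        omega
      · have := hi.1 (j - 1) (by omega)
        omega
    · intro j hj
      dsimp only
      split_ifs with h1 h2
      · exact hc.2 j (by omega)
      · have : j = k := by omega
        subst this
        simp only [Nat.add_sub_cancel]
        omega
      · omega
      · have := hi.2 (j - 1) (by omega)
        have e : j - 1 + 1 = j := by omega
        rw [e] at this
        simpa using this
    · intro j hj
      dsimp only
      split_ifs with h1
      · exact hcU j (by omega)
      · exact hiU (j - 1) (by omega)
  have B : ∀ k, k + 1 < s → c (k + 1) < i k + 2 := by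
    intro k hk
    by_contra h
    apply N2
    refine ⟨fun j => if j ≤ k then i j else c j, ⟨?_, ?_⟩, ?_⟩
    · intro j hj
      have h1 := hi.1 j hj
      have h3 := hc.1 j hj
      have h4 := hc.1 (k + 1) hk
      dsimp only
      split_ifs with h2
      · rcases h2.eq_or_lt with rfl | h2
        · omega
        · have := hi.lt h2 (by omega)
          omega
      · rcases (show k + 1 ≤ j by omega).eq_or_lt with rfl | h2
        · have := hi.1 k (by omega); omega
        · have := hc.lt h2 hj
          have := hi.1 k (by omega)
          omega
    · intro j hj
      dsimp only
      split_ifs with h1 h2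
      · exact hi.2 j hj
      · have : j = k := by omega
        subst this
        omega
      · omega
      · exact hc.2 j hj
    · intro j hj
      dsimp only
      split_ifs with h1
      · exact hiU j hj
      · exact hcU j hj
  have key : ∀ k, k < s → c k = a + 2 * k ∧ i k = a + 2 * k + 1 := by
    intro k
    induction k with
    | zero =>
      intro h
      have := A 0 h
      have := hi.1 0 h
      omega
    | succ k ih =>
      intro h
      have := ih (by omega)
      have := A (k + 1) h
      have := B k h
      have := hc.2 k h
      have := hi.2 k h
      omega
  have h1 := key (s - 1) (by omega)
  have h2 := hi.1 (s - 1) (by omega)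
  apply N2
  refine ⟨i, ⟨fun k hk => ?_, hi.2⟩, hiU⟩
  have := hhigh k hk
  have := hi.1 k hk
  omega

lemma comb2 (U : ℕ → Prop) (a b s : ℕ) (hs : 1 ≤ s) (hb : b + 1 ≠ a + 2 * s)
    (hc : HasChain U a b s) (hi : HasChain U (a + 1) (b - 1) (s - 1)) :
    HasChain U a (b - 1) s ∨ HasChain U (a + 1) b s := by
  by_contra hcon
  push Not at hcon
  obtain ⟨N1, N2⟩ := hcon
  obtain ⟨c, hc, hcU⟩ := hc
  obtain ⟨i, hi, hiU⟩ := hi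
  have hlow : ∀ k < s, c 0 ≤ c k := by
    intro k hk
    rcases Nat.eq_zero_or_pos k with rfl | h
    · exact le_rfl
    · have := hc.lt h hk
      omega
  have hhigh : ∀ k < s, c k ≤ c (s - 1) := by
    intro k hk
    rcases eq_or_ne k (s - 1) with rfl | h
    · exact le_rfl
    · have := hc.lt (show k < s - 1 by omega) (by omega)
      omega
  have hc0 : c 0 = a := by
    by_contra h
    apply N2
    refine ⟨c, ⟨fun k hk => ?_, hc.2⟩, hcU⟩
    have := hc.1 k hk
    have := hc.1 0 (by omega)
    have := hlow k hk
    omega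
  have A : ∀ k < s - 1, i k < c k + 2 := by
    intro k hk
    by_contra h
    apply N1
    refine ⟨fun j => if j ≤ k then c j else i (j - 1), ⟨?_, ?_⟩, ?_⟩
    · intro j hj
      dsimp only
      split_ifs with h1
      · have := hc.1 j (by omega)
        have := hi.1 k hk
        rcases h1.eq_or_lt with rfl | h2
        · omega
        · have := hc.lt h2 (by omega)
          omega
      · have := hi.1 (j - 1) (by omega)
        omega
    · intro j hj
      dsimp only
      split_ifs with h1 h2
      · exact hc.2 j (by omega)
      · have : j = k := by omega
        subst this
        simp only [Nat.add_sub_cancel]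
        omega
      · omega
      · have := hi.2 (j - 1) (by omega)
        have e : j - 1 + 1 = j := by omega
        rw [e] at this
        simpa using this
    · intro j hj
      dsimp only
      split_ifs with h1
      · exact hcU j (by omega)
      · exact hiU (j - 1) (by omega)
  have B : ∀ k, k + 1 < s → c (k + 1) < i k + 2 := by
    intro k hk
    by_contra h
    apply N2
    refine ⟨fun j => if j ≤ k then i j else c j, ⟨?_, ?_⟩, ?_⟩
    · intro j hj
      have h3 := hc.1 j hj
      have h4 := hc.1 (k + 1) hk
      dsimp only
      split_ifs with h2
      · have := hi.1 j (by omega)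
        omega
      · rcases (show k + 1 ≤ j by omega).eq_or_lt with rfl | h2
        · have := hi.1 k (by omega); omega
        · have := hc.lt h2 hj
          have := hi.1 k (by omega)
          omega
    · intro j hj
      dsimp only
      split_ifs with h1 h2
      · exact hi.2 j (by omega)
      · have : j = k := by omega
        subst this
        omega
      · omega
      · exact hc.2 j hj
    · intro j hj
      dsimp only
      split_ifs with h1
      · exact hiU j (by omega)
      · exact hcU j hj
  have key : ∀ k, k < s → c k = a + 2 * k := by
    intro k
    induction k with
    | zero =>
      intro h
      omega
    | succ k ih =>
      intro h
      have := ih (by omega)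
      have := A k (by omega)
      have := B k h
      have := hc.2 k h
      omega
  have h1 := key (s - 1) (by omega)
  have h2 := hc.1 (s - 1) (by omega)
  apply N1
  refine ⟨c, ⟨fun k hk => ?_, hc.2⟩, hcU⟩
  have := hhigh k hk
  have := hc.1 k hk
  omega

section
variable {K : Type u} [Field K] {n : ℕ}

lemma eq_qq {a b s : ℕ} (hb : b ≤ n) (G : Ideal (MvPolynomial (Fin n) K))
    (hG : ∀ c, IsChain2 s a b c → DD K n s c ∈ G) (hGq : G ≤ qq K n a b s) :
    G = qq K n a b s := by
  refine le_antisymm hGq fun f hf => ?_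
  obtain ⟨w, hw⟩ := exists_Lo f
  obtain ⟨h, h1, -, h3⟩ := reduce G (Bad a b s) (fun d hd => by
    obtain ⟨c, hc, g, hg⟩ := bad_step (K := K) hb d hd
    exact ⟨_, G.mul_mem_left g (hG c hc), hg⟩) w f hw
  have h4 : h ∈ qq K n a b s := by
    have := (qq K n a b s).sub_mem hf (hGq h1)
    simpa using this
  have := std_eq_zero a b s hb h h4 h3
  subst this
  simpa using h1

lemma qq_eq_span {a b s : ℕ} (hb : b ≤ n) :
    qq K n a b s = Ideal.span {f | ∃ c, IsChain2 s a b c ∧ f = DD K n s c} := by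
  symm
  apply eq_qq hb
  · intro c hc
    exact Ideal.subset_span ⟨c, hc, rfl⟩
  · rw [Ideal.span_le]
    rintro _ ⟨c, hc, rfl⟩
    exact DD_mem_qq hb hc

lemma qq_le {a b s : ℕ} (hb : b ≤ n) {G : Ideal (MvPolynomial (Fin n) K)}
    (hG : ∀ c, IsChain2 s a b c → DD K n s c ∈ G) : qq K n a b s ≤ G := by
  rw [qq_eq_span hb, Ideal.span_le]
  rintro _ ⟨c, hc, rfl⟩
  exact hG c hc

lemma qq_top {a b s : ℕ} (hb : b ≤ n) {f : MvPolynomial (Fin n) K} (hf : f ∈ qq K n a b s)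
    {d : Fin n →₀ ℕ} (hd : coeff d f ≠ 0) (hmax : ∀ e, coeff e f ≠ 0 → wt e ≤ wt d) :
    Bad a b s d := 
  top_of_std (qq K n a b s) (qq K n a b s) (Bad a b s) (fun d hd => by
    obtain ⟨c, hc, g, hg⟩ := bad_step (K := K) hb d hd
    exact ⟨_, Ideal.mul_mem_left _ g (DD_mem_qq hb hc), hg⟩) le_rfl (std_eq_zero a b s hb)
    f hf d hd hmax

lemma DD_coeff {s a b : ℕ} {c : ℕ → ℕ} (h : IsChain2 s a b c) (hb : b ≤ n) :
    coeff (lexp n s c) (DD K n s c) = 1 ∧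
      ∀ e, coeff e (DD K n s c) ≠ 0 → wt e ≤ wt (lexp n s c) := by
  classical
  have hl := DD_lead (K := K) h hb
  constructor
  · by_contra h1
    refine lt_irrefl _ (hl (lexp n s c) ?_)
    rw [coeff_sub, coeff_monomial, if_pos rfl, sub_ne_zero]
    exact fun h2 => h1 h2.symm
  · intro e he
    by_cases h1 : lexp n s c = e
    · rw [h1]
    · refine (hl e ?_).le
      rw [coeff_sub, coeff_monomial, if_neg h1, zero_sub]
      exact neg_ne_zero.2 he

lemma DD_not_mem {s a b a' b' s' : ℕ} {c : ℕ → ℕ} (h : IsChain2 s a b c) (hb : b ≤ n)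
    (hb' : b' ≤ n) (hn : ¬ HasChain (fun k => ∃ j < s, c j = k) a' b' s') :
    DD K n s c ∉ qq K n a' b' s' := by
  intro hm
  obtain ⟨h1, h2⟩ := DD_coeff (K := K) h hb
  obtain ⟨c', hc', hU⟩ := qq_top hb' hm (by rw [h1]; exact one_ne_zero) h2
  exact hn ⟨c', hc', fun k hk => sp_lexp h _ (hU k hk)⟩

lemma DD_ne_zero {s a b : ℕ} {c : ℕ → ℕ} (h : IsChain2 s a b c) (hb : b ≤ n) :
    DD K n s c ≠ 0 := by
  intro h0
  have h1 := (DD_coeff (K := K) h hb).1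
  rw [h0, coeff_zero] at h1
  exact zero_ne_one h1

lemma qq_mono {a b a' b' s : ℕ} (ha : a ≤ a') (hb : b' ≤ b) (hn : b ≤ n) :
    qq K n a' b' s ≤ qq K n a b s := by
  refine qq_le (hb.trans hn) fun c hc => DD_mem_qq hn ⟨fun k hk => ?_, hc.2⟩
  have := hc.1 k hk
  omega

lemma qq_succ_le_right {a b s : ℕ} (hb : b ≤ n) :
    qq K n a b (s + 1) ≤ qq K n a (b - 1) s := by
  refine qq_le hb fun c hc => ?_
  rw [DD, Matrix.det_succ_row _ (Fin.last s)]
  refine Ideal.sum_mem _ fun j _ => Ideal.mul_mem_left _ _ ?_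
  have h := det_mem_qq (K := K) (n := n) (a := a) (b := b - 1) (by omega)
    (fun i : Fin s => c (Fin.castSucc i) / 2) (fun k : Fin s => (c (j.succAbove k) + 1) / 2) ?_
  rotate_left
  · intro i k
    have h1 := hc.lt (show (i.castSucc : ℕ) < s by simp) (by omega)
    have h2 := hc.1 s (by omega)
    have h3 := hc.1 (j.succAbove k) (j.succAbove k).2
    have h4 := hc.1 i.castSucc (by simp)
    omega
  · convert h using 2
    ext i k
    simp [Matrix.submatrix_apply]

lemma qq_succ_le_left {a b s : ℕ} (hb : b ≤ n) :
    qq K n a b (s + 1) ≤ qq K n (a + 1) b s := by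
  refine qq_le hb fun c hc => ?_
  rw [DD, Matrix.det_succ_row_zero]
  refine Ideal.sum_mem _ fun j _ => Ideal.mul_mem_left _ _ ?_
  have h := det_mem_qq (K := K) (n := n) (a := a + 1) (b := b) (by omega)
    (fun i : Fin s => c (Fin.succ i) / 2) (fun k : Fin s => (c (j.succAbove k) + 1) / 2) ?_
  rotate_left
  · intro i k
    have h1 := hc.lt (show 0 < (i.succ : ℕ) by simp) i.succ.2
    have h2 := hc.1 0 (by omega)
    have h3 := hc.1 (j.succAbove k) (j.succAbove k).2
    have h4 := hc.1 i.succ i.succ.2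
    omega
  · convert h using 2
    ext i k
    simp [Matrix.submatrix_apply]

/-- general intersection lemma -/
lemma inf_eq {a₁ b₁ s₁ a₂ b₂ s₂ a₃ b₃ s₃ a₄ b₄ s₄ : ℕ} (h1 : b₁ ≤ n) (h2 : b₂ ≤ n) (h3 : b₃ ≤ n)
    (h4 : b₄ ≤ n)
    (hle : qq K n a₁ b₁ s₁ ⊔ qq K n a₂ b₂ s₂ ≤ qq K n a₃ b₃ s₃ ⊓ qq K n a₄ b₄ s₄)
    (hcomb : ∀ U, HasChain U a₃ b₃ s₃ → HasChain U a₄ b₄ s₄ →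
      HasChain U a₁ b₁ s₁ ∨ HasChain U a₂ b₂ s₂) :
    qq K n a₁ b₁ s₁ ⊔ qq K n a₂ b₂ s₂ = qq K n a₃ b₃ s₃ ⊓ qq K n a₄ b₄ s₄ := by
  refine le_antisymm hle fun f hf => ?_
  set G := qq K n a₁ b₁ s₁ ⊔ qq K n a₂ b₂ s₂ with hG
  obtain ⟨w, hw⟩ := exists_Lo f
  obtain ⟨h, e1, -, e3⟩ := reduce G (fun d => Bad a₁ b₁ s₁ d ∨ Bad a₂ b₂ s₂ d) (fun d hd => by
    rcases hd with hd | hd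
    · obtain ⟨c, hc, g, hg⟩ := bad_step (K := K) h1 d hd
      exact ⟨_, G.mul_mem_left g ((le_sup_left : _ ≤ G) (DD_mem_qq h1 hc)), hg⟩
    · obtain ⟨c, hc, g, hg⟩ := bad_step (K := K) h2 d hd
      exact ⟨_, G.mul_mem_left g ((le_sup_right : _ ≤ G) (DD_mem_qq h2 hc)), hg⟩) w f hw
  have hm : h ∈ qq K n a₃ b₃ s₃ ⊓ qq K n a₄ b₄ s₄ := by
    have := Ideal.sub_mem _ hf (hle e1)
    simpa using this
  by_cases h0 : h = 0
  · subst h0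
    simpa using e1
  · exfalso
    obtain ⟨d, hd, hmax⟩ := Finset.exists_max_image h.support wt (by simpa using h0)
    rw [mem_support_iff] at hd
    have hmax' : ∀ e, coeff e h ≠ 0 → wt e ≤ wt d := fun e he => hmax e (mem_support_iff.2 he)
    exact e3 d hd (hcomb _ (qq_top h3 hm.1 hd hmax') (qq_top h4 hm.2 hd hmax'))

lemma inf_eq1 {a b s : ℕ} (hb : b ≤ n) (hs : 1 ≤ s) (hne : b ≠ a + 2 * s) :
    qq K n a b (s + 1) ⊔ qq K n (a + 1) (b - 1) s = qq K n a (b - 1) s ⊓ qq K n (a + 1) b s :=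
  inf_eq hb (by omega) (by omega) hb (sup_le (le_inf (qq_succ_le_right hb) (qq_succ_le_left hb))
    (le_inf (qq_mono (by omega) le_rfl (by omega)) (qq_mono le_rfl (by omega) hb)))
    fun U => comb1 U a b s hs hne

/-- (E2) -/
lemma inf_eq2 {a b s : ℕ} (hb : b ≤ n) (hne : b ≠ a + 2 * s + 1) :
    qq K n a (b - 1) (s + 1) ⊔ qq K n (a + 1) b (s + 1) =
      qq K n a b (s + 1) ⊓ qq K n (a + 1) (b - 1) s :=
  inf_eq (by omega) hb hb (by omega) (sup_le (le_inf (qq_mono le_rfl (by omega) hb)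
      (qq_succ_le_left (by omega)))
    (le_inf (qq_mono (by omega) le_rfl hb) (qq_succ_le_right hb)))
    fun U => comb2 U a b (s + 1) (by omega) (by omega)

end

end HK

namespace HK

open MvPolynomial

section
variable {K : Type u} [Field K] {n : ℕ}

lemma minors_eq {r s t off b : ℕ} (hb : b ≤ n) (hrs : r + s + off = b + 1)
    (M : Matrix (Fin r) (Fin s) (MvPolynomial (Fin n) K))
    (hM : ∀ i j, M i j = xv K n (i + j + off))
    (hD : ∀ c, IsChain2 t off b c → ∃ (ρ : Fin t → Fin r) (γ : Fin t → Fin s),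
      StrictMono ρ ∧ StrictMono γ ∧ DD K n t c = (M.submatrix ρ γ).det) :
    minorsIdeal t M = qq K n off b t := by
  apply eq_qq hb
  · intro c hc
    obtain ⟨ρ, γ, h1, h2, h3⟩ := hD c hc
    exact Ideal.subset_span ⟨ρ, γ, h1, h2, h3⟩
  · rw [minorsIdeal, Ideal.span_le]
    rintro _ ⟨ρ, γ, -, -, rfl⟩
    have h := det_mem_qq (K := K) (n := n) (a := off) (b := b) hb
      (fun i : Fin t => (ρ i : ℕ)) (fun j : Fin t => (γ j : ℕ) + off) (by
        intro i j
        have := (ρ i).2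
        have := (γ j).2
        omega)
    have e : M.submatrix ρ γ = Matrix.of fun i j : Fin t => xv K n (ρ i + (γ j + off)) := by
      ext i j
      rw [Matrix.submatrix_apply, hM, Matrix.of_apply, add_assoc]
    rw [e]
    exact h

lemma minors_eq' {r s t off b : ℕ} (hb : b ≤ n) (hrs : r + s + off = b + 1)
    (M : Matrix (Fin r) (Fin s) (MvPolynomial (Fin n) K))
    (hM : ∀ i j, M i j = xv K n (i + j + off)) (p g : ℕ → ℕ)
    (hp : ∀ x, off ≤ x → x < b → p x < r) (hg : ∀ x, off ≤ x → x < b → g x < s)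
    (hpm : ∀ x y, off ≤ x → x + 2 ≤ y → p x < p y) (hgm : ∀ x y, off ≤ x → x + 2 ≤ y → g x < g y)
    (hpg : (∀ x y, off ≤ x → off ≤ y → p x + g y + off = x / 2 + (y + 1) / 2) ∨
      (∀ x y, off ≤ x → off ≤ y → p x + g y + off = y / 2 + (x + 1) / 2)) :
    minorsIdeal t M = qq K n off b t := by
  refine minors_eq hb hrs M hM fun c hc => ?_
  have h1 : ∀ k : Fin t, off ≤ c k ∧ c k < b := fun k => hc.1 k k.2
  refine ⟨fun k => ⟨p (c k), hp _ (h1 k).1 (h1 k).2⟩, fun k => ⟨g (c k), hg _ (h1 k).1 (h1 k).2⟩,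
    ?_, ?_, ?_⟩
  · intro i j hij
    exact hpm _ _ (h1 i).1 (hc.lt hij j.2)
  · intro i j hij
    exact hgm _ _ (h1 i).1 (hc.lt hij j.2)
  · rcases hpg with hpg | hpg
    · rw [DD]
      congr 1
      ext i j
      rw [Matrix.submatrix_apply, hM, Matrix.of_apply]
      dsimp only
      rw [hpg _ _ (h1 i).1 (h1 j).1]
    · rw [DD, ← Matrix.det_transpose]
      congr 1
      ext i j
      rw [Matrix.submatrix_apply, hM, Matrix.transpose_apply, Matrix.of_apply]
      dsimp only
      rw [hpg _ _ (h1 i).1 (h1 j).1]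

lemma minorsX (m t : ℕ) (hm : 1 ≤ m) :
    minorsIdeal t (hankelX K m) = qq K (2 * m - 1) 0 (2 * m - 1) t := by
  refine minors_eq' le_rfl (by omega) _ (fun i j => ?_) (fun x => x / 2) (fun x => (x + 1) / 2)
    ?_ ?_ ?_ ?_ (Or.inl ?_)
  · rw [xv_of_lt (by omega)]; rfl
  all_goals intros; omega

lemma minorsP1 (m t : ℕ) (hm : 2 ≤ m) :
    minorsIdeal t (hankelP1 K m) = qq K (2 * m - 1) 0 (2 * m - 1 - 1) t := by
  refine minors_eq' (by omega) (by omega) _ (fun i j => ?_) (fun x => x / 2) (fun x => (x + 1) / 2)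
    ?_ ?_ ?_ ?_ (Or.inl ?_)
  · rw [xv_of_lt (by omega)]; rfl
  all_goals intros; omega

lemma minorsP2 (m t : ℕ) (hm : 2 ≤ m) :
    minorsIdeal t (hankelP2 K m) = qq K (2 * m - 1) 1 (2 * m - 1) t := by
  refine minors_eq' (by omega) (by omega) _ (fun i j => ?_) (fun x => x / 2)
    (fun x => (x + 1) / 2 - 1) ?_ ?_ ?_ ?_ (Or.inl ?_)
  · rw [xv_of_lt (by omega)]; rfl
  all_goals intros; omega

lemma minorsQ (m t : ℕ) (hm : 2 ≤ m) :
    minorsIdeal t (hankelQ K m) = qq K (2 * m - 1) 1 (2 * m - 1 - 1) t := by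
  refine minors_eq' (by omega) (by omega) _ (fun i j => ?_) (fun x => (x + 1) / 2 - 1)
    (fun x => x / 2) ?_ ?_ ?_ ?_ (Or.inr ?_)
  · rw [xv_of_lt (by omega)]; rfl
  all_goals intros; omega

lemma chain_index {s a b a' b' s' : ℕ} {c : ℕ → ℕ} (h : IsChain2 s a b c)
    (hn : HasChain (fun k => ∃ j < s, c j = k) a' b' s') :
    ∃ j : ℕ → ℕ, (∀ k < s', j k < s ∧ a' ≤ c (j k) ∧ c (j k) < b') ∧
      ∀ k < s', j 0 + k ≤ j k := by
  obtain ⟨c', hc', hU⟩ := hn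
  have : ∀ k, ∃ j, k < s' → j < s ∧ c j = c' k := by
    intro k
    by_cases hk : k < s'
    · obtain ⟨j, hj, e⟩ := hU k hk
      exact ⟨j, fun _ => ⟨hj, e⟩⟩
    · exact ⟨0, fun h => absurd h hk⟩
  choose j hj using this
  refine ⟨j, fun k hk => ⟨(hj k hk).1, ?_⟩, ?_⟩
  · rw [(hj k hk).2]
    exact hc'.1 k hk
  · intro k
    induction k with
    | zero => intro _; omega
    | succ k ih =>
      intro hk
      have h1 := ih (by omega)
      have h2 := hj k (by omega)
      have h3 := hj (k + 1) hk
      have h4 := hc'.2 k hk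
      have h5 : j k < j (k + 1) := by
        by_contra h6
        rcases (not_lt.1 h6).eq_or_lt with h7 | h7
        · rw [h7] at h3
          omega
        · have := h.lt h7 h2.1
          omega
      omega

lemma no_chain_len {s a b a' b' s' : ℕ} {c : ℕ → ℕ} (h : IsChain2 s a b c) (hs : s < s') :
    ¬ HasChain (fun k => ∃ j < s, c j = k) a' b' s' := by
  intro hn
  obtain ⟨j, h1, h2⟩ := chain_index h hn
  have := h1 (s' - 1) (by omega)
  have := h2 (s' - 1) (by omega)
  omega

lemma no_chain_last {s a b a' b' : ℕ} {c : ℕ → ℕ} (h : IsChain2 (s + 1) a b c) (hs : b' ≤ c s) :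
    ¬ HasChain (fun k => ∃ j < s + 1, c j = k) a' b' (s + 1) := by
  intro hn
  obtain ⟨j, h1, h2⟩ := chain_index h hn
  have h3 := h1 s (by omega)
  have h4 := h2 s (by omega)
  have h5 : j s = s := by omega
  rw [h5] at h3
  omega

lemma no_chain_first {s a b a' b' : ℕ} {c : ℕ → ℕ} (h : IsChain2 (s + 1) a b c) (hs : c 0 < a') :
    ¬ HasChain (fun k => ∃ j < s + 1, c j = k) a' b' (s + 1) := by
  intro hn
  obtain ⟨j, h1, h2⟩ := chain_index h hn
  have h3 := h1 s (by omega)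
  have h4 := h2 s (by omega)
  have h5 : j 0 = 0 := by omega
  have h6 := h1 0 (by omega)
  rw [h5] at h6
  omega

lemma chain_left {s a b : ℕ} (h : a + 2 * s ≤ b + 1) : IsChain2 s a b (fun k => a + 2 * k) :=
  ⟨fun k hk => by dsimp only; omega, fun k hk => by dsimp only; omega⟩

lemma chain_right {s a b : ℕ} (h : a + 2 * s ≤ b + 1) :
    IsChain2 s a b (fun k => b + 1 + 2 * k - 2 * s) :=
  ⟨fun k hk => by dsimp only; omega, fun k hk => by dsimp only; omega⟩

lemma not_le_len {s a b a' b' s' : ℕ} (hb : b ≤ n) (hb' : b' ≤ n) (h : a + 2 * s ≤ b + 1)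
    (hs : s < s') : ¬ qq K n a b s ≤ qq K n a' b' s' := fun hle =>
  DD_not_mem (chain_left h) hb hb' (no_chain_len (chain_left h) hs)
    (hle (DD_mem_qq hb (chain_left h)))

lemma not_le_right {s a b a' b' : ℕ} (hb : b ≤ n) (hb' : b' < b) (h : a + 2 * (s + 1) ≤ b + 1) :
    ¬ qq K n a b (s + 1) ≤ qq K n a' b' (s + 1) := fun hle =>
  DD_not_mem (chain_right h) hb (by omega) (no_chain_last (chain_right h) (by omega))
    (hle (DD_mem_qq hb (chain_right h)))

lemma not_le_left {s a b a' b' : ℕ} (hb : b ≤ n) (hb' : b' ≤ n) (ha : a < a')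
    (h : a + 2 * (s + 1) ≤ b + 1) :
    ¬ qq K n a b (s + 1) ≤ qq K n a' b' (s + 1) := fun hle =>
  DD_not_mem (chain_left h) hb hb' (no_chain_first (chain_left h) (by omega))
    (hle (DD_mem_qq hb (chain_left h)))

/-- the chain of primes -/
noncomputable def pp (K : Type u) [Field K] (n e : ℕ) : PrimeSpectrum (MvPolynomial (Fin n) K) :=
  ⟨qq K n 0 (n - e % 2) (e / 2 + 1), qq_prime _ _ _⟩

lemma pp_lt {e : ℕ} (he : e + 1 ≤ n) : pp K n (e + 1) < pp K n e := by
  rw [← PrimeSpectrum.asIdeal_lt_asIdeal]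
  simp only [pp]
  obtain ⟨r, hr | hr⟩ : ∃ r, e = 2 * r ∨ e = 2 * r + 1 := ⟨e / 2, by omega⟩
  · subst hr
    have e1 : (2 * r + 1) % 2 = 1 := by omega
    have e2 : 2 * r % 2 = 0 := by omega
    have e3 : (2 * r + 1) / 2 = r := by omega
    have e4 : 2 * r / 2 = r := by omega
    rw [e1, e2, e3, e4]
    exact lt_of_le_not_ge (qq_mono le_rfl (by omega) (by omega))
      (not_le_right (by omega) (by omega) (by omega))
  · subst hr
    have e1 : (2 * r + 1 + 1) % 2 = 0 := by omega
    have e2 : (2 * r + 1) % 2 = 1 := by omega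
    have e3 : (2 * r + 1 + 1) / 2 = r + 1 := by omega
    have e4 : (2 * r + 1) / 2 = r := by omega
    rw [e1, e2, e3, e4]
    exact lt_of_le_not_ge (qq_succ_le_right (by omega))
      (not_le_len (by omega) (by omega) (by omega) (by omega))

lemma height_pp {e : ℕ} (he : e ≤ n) : Order.height (pp K n e) = (n - e : ℕ) := by
  have h1 : ∀ e ≤ n, Order.height (pp K n e) + e ≤ Order.height (pp K n 0) := by
    intro e
    induction e with
    | zero => intro _; simp
    | succ e ih =>
      intro he
      refine le_trans ?_ (ih (by omega))
      have := Order.height_add_one_le (pp_lt (K := K) he)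
      push_cast
      rw [add_comm (e : ℕ∞) 1, ← add_assoc]
      gcongr
  have h2 : Order.height (pp K n 0) ≤ n := by
    have h3 := Order.height_le_krullDim (pp K n 0)
    have h4 : Order.krullDim (PrimeSpectrum (MvPolynomial (Fin n) K)) = n := by
      have := MvPolynomial.ringKrullDim_of_isNoetherianRing (R := K) (ι := Fin n)
      rw [ringKrullDim_eq_zero_of_field, zero_add] at this
      rwa [Nat.card_fin] at this
    rw [h4] at h3
    exact_mod_cast h3
  have h3 : ∀ k ≤ n, (k : ℕ∞) ≤ Order.height (pp K n (n - k)) := by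
    intro k
    induction k with
    | zero => simp
    | succ k ih =>
      intro hk
      have h5 := Order.height_add_one_le (pp_lt (K := K) (n := n) (e := n - (k + 1)) (by omega))
      have e1 : n - (k + 1) + 1 = n - k := by omega
      rw [e1] at h5
      refine le_trans ?_ h5
      push_cast
      gcongr
      exact ih (by omega)
  have h4 := h3 (n - e) (by omega)
  have e1 : n - (n - e) = e := by omega
  rw [e1] at h4
  refine le_antisymm ?_ h4
  have h5 := (h1 e he).trans h2
  have e2 : (n : ℕ∞) = ((n - e : ℕ) : ℕ∞) + e := by
    rw [← Nat.cast_add]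
    congr 1
    omega
  rw [e2] at h5
  exact (ENat.add_le_add_iff_right (ENat.natCast_ne_top e)).1 h5

lemma idealHeight_prime {R : Type*} [CommRing R] (p : PrimeSpectrum R) :
    idealHeight p.asIdeal = Order.height p := by
  rw [idealHeight]
  haveI := p.isPrime
  apply le_antisymm
  · exact iInf₂_le p (by rw [Ideal.minimalPrimes_eq_subsingleton_self]; rfl)
  · refine le_iInf₂ fun q hq => ?_
    rw [Ideal.minimalPrimes_eq_subsingleton_self, Set.mem_singleton_iff] at hq
    rw [PrimeSpectrum.ext hq]

lemma idealHeight_sum {R : Type*} [CommRing R] (I : Ideal R) (p p' : PrimeSpectrum R)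
    (h1 : p.asIdeal < I) (h2 : I ≤ p'.asIdeal) (k : ℕ∞) (hp : k ≤ Order.height p + 1)
    (hp' : Order.height p' ≤ k) : idealHeight I = k := by
  apply le_antisymm
  · haveI := p'.isPrime
    obtain ⟨q, hq, hqp⟩ := Ideal.exists_minimalPrimes_le h2
    refine (iInf₂_le (⟨q, hq.1.1⟩ : PrimeSpectrum R) hq).trans (le_trans ?_ hp')
    exact Order.height_mono (a := (⟨q, hq.1.1⟩ : PrimeSpectrum R)) hqp
  · refine le_iInf₂ fun q hq => hp.trans (Order.height_add_one_le ?_)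
    rw [← PrimeSpectrum.asIdeal_lt_asIdeal]
    exact h1.trans_le hq.1.2

lemma height_between {R : Type*} [CommRing R] (p q p' : PrimeSpectrum R) (k : ℕ)
    (h1 : p < q) (h2 : q < p') (hp : Order.height p = k) (hp' : Order.height p' = (k + 2 : ℕ)) :
    Order.height q = (k + 1 : ℕ) := by
  have e1 := Order.height_add_one_le h1
  have e2 := Order.height_add_one_le h2
  rw [hp] at e1
  rw [hp'] at e2
  apply le_antisymm
  · have : ((k + 2 : ℕ) : ℕ∞) = ((k + 1 : ℕ) : ℕ∞) + 1 := by push_cast; rw [add_assoc]; rfl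
    rw [this] at e2
    exact (ENat.add_le_add_iff_right ENat.one_ne_top).1 e2
  · exact_mod_cast e1

lemma heights (m t : ℕ) (ht2 : 2 ≤ t) (htm : t ≤ m) :
    idealHeight (minorsIdeal t (hankelX K m)) = (2 * (m - t) + 1 : ℕ) ∧
    idealHeight (minorsIdeal (t - 1) (hankelQ K m)) = (2 * (m - t) + 1 : ℕ) ∧
    idealHeight (minorsIdeal t (hankelX K m) + minorsIdeal (t - 1) (hankelQ K m)) =
      (2 * (m - t) + 2 : ℕ) ∧
    idealHeight (minorsIdeal (t - 1) (hankelP1 K m)) = (2 * (m - t) + 2 : ℕ) ∧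
    idealHeight (minorsIdeal (t - 1) (hankelP2 K m)) = (2 * (m - t) + 2 : ℕ) ∧
    idealHeight (minorsIdeal (t - 1) (hankelP1 K m) + minorsIdeal (t - 1) (hankelP2 K m)) =
      (2 * (m - t) + 3 : ℕ) := by
  rw [minorsX m t (by omega), minorsQ m _ (by omega), minorsP1 m _ (by omega),
    minorsP2 m _ (by omega)]
  obtain ⟨s, rfl⟩ : ∃ s, t = s + 2 := ⟨t - 2, by omega⟩
  have es : s + 2 - 1 = s + 1 := by omega
  rw [es]
  set n := 2 * m - 1 with hn
  have hX : (pp K n (2 * s + 2)).asIdeal = qq K n 0 n (s + 2) := by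
    have e1 : (2 * s + 2) % 2 = 0 := by omega
    have e2 : (2 * s + 2) / 2 = s + 1 := by omega
    simp only [pp, e1, e2, Nat.sub_zero]
  have hX' : (pp K n (2 * s)).asIdeal = qq K n 0 n (s + 1) := by
    have e1 : (2 * s) % 2 = 0 := by omega
    have e2 : (2 * s) / 2 = s := by omega
    simp only [pp, e1, e2, Nat.sub_zero]
  have hP : (pp K n (2 * s + 1)).asIdeal = qq K n 0 (n - 1) (s + 1) := by
    have e1 : (2 * s + 1) % 2 = 1 := by omega
    have e2 : (2 * s + 1) / 2 = s := by omega
    simp only [pp, e1, e2]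
  have hP' : (pp K n (2 * s + 3)).asIdeal = qq K n 0 (n - 1) (s + 2) := by
    have e1 : (2 * s + 3) % 2 = 1 := by omega
    have e2 : (2 * s + 3) / 2 = s + 1 := by omega
    simp only [pp, e1, e2]
  have gX := height_pp (K := K) (n := n) (e := 2 * s + 2) (by omega)
  have gX' := height_pp (K := K) (n := n) (e := 2 * s) (by omega)
  have gP := height_pp (K := K) (n := n) (e := 2 * s + 1) (by omega)
  have gP' := height_pp (K := K) (n := n) (e := 2 * s + 3) (by omega)
  have eX : n - (2 * s + 2) = 2 * (m - (s + 2)) + 1 := by omega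
  have eX' : n - (2 * s) = 2 * (m - (s + 2)) + 3 := by omega
  have eP : n - (2 * s + 1) = 2 * (m - (s + 2)) + 2 := by omega
  have eP' : n - (2 * s + 3) = 2 * (m - (s + 2)) := by omega
  rw [eX] at gX
  rw [eX'] at gX'
  rw [eP] at gP
  rw [eP'] at gP'
  let pQ : PrimeSpectrum (MvPolynomial (Fin n) K) := ⟨qq K n 1 (n - 1) (s + 1), qq_prime _ _ _⟩
  let pP2 : PrimeSpectrum (MvPolynomial (Fin n) K) := ⟨qq K n 1 n (s + 1), qq_prime _ _ _⟩
  refine ⟨?_, ?_, ?_, ?_, ?_, ?_⟩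
  · rw [← hX, idealHeight_prime, gX]
  · refine (idealHeight_prime pQ).trans (height_between (pp K n (2 * s + 3)) pQ
      (pp K n (2 * s + 1)) _ ?_ ?_ gP' gP)
    · rw [← PrimeSpectrum.asIdeal_lt_asIdeal, hP']
      exact lt_of_le_not_ge (qq_succ_le_left (by omega))
        (not_le_len (by omega) (by omega) (by omega) (by omega))
    · rw [← PrimeSpectrum.asIdeal_lt_asIdeal, hP]
      exact lt_of_le_not_ge (qq_mono (by omega) le_rfl (by omega))
        (not_le_left (by omega) (by omega) (by omega) (by omega))
  · refine idealHeight_sum _ (pp K n (2 * s + 2)) (pp K n (2 * s + 1)) ?_ ?_ _ ?_ gP.le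
    · rw [hX, Submodule.add_eq_sup, left_lt_sup]
      exact not_le_len (by omega) (by omega) (by omega) (by omega)
    · rw [hP, Submodule.add_eq_sup]
      exact sup_le (qq_succ_le_right le_rfl) (qq_mono (by omega) le_rfl (by omega))
    · rw [gX]
      exact_mod_cast le_rfl
  · rw [← hP, idealHeight_prime, gP]
  · refine (idealHeight_prime pP2).trans (height_between (pp K n (2 * s + 2)) pP2
      (pp K n (2 * s)) _ ?_ ?_ gX gX')
    · rw [← PrimeSpectrum.asIdeal_lt_asIdeal, hX]
      exact lt_of_le_not_ge (qq_succ_le_left (by omega))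
        (not_le_len (by omega) (by omega) (by omega) (by omega))
    · rw [← PrimeSpectrum.asIdeal_lt_asIdeal, hX']
      exact lt_of_le_not_ge (qq_mono (by omega) le_rfl (by omega))
        (not_le_left (by omega) (by omega) (by omega) (by omega))
  · refine idealHeight_sum _ (pp K n (2 * s + 1)) (pp K n (2 * s)) ?_ ?_ _ ?_ gX'.le
    · rw [hP, Submodule.add_eq_sup, left_lt_sup]
      exact not_le_right (by omega) (by omega) (by omega)
    · rw [hX', Submodule.add_eq_sup]
      exact sup_le (qq_mono le_rfl (by omega) le_rfl) (qq_mono (by omega) le_rfl le_rfl)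
    · rw [gP]
      exact_mod_cast le_rfl

end

end HK

namespace HK

open MvPolynomial

section
variable {K S : Type u} [Field K] [CommRing S] [Algebra K S]

/-- polynomial extension of subalgebras -/
structure PStep (B A : Subalgebra K S) (θ : S) : Prop where
  le : B ≤ A
  mem : θ ∈ A
  inj : Function.Injective (Polynomial.aeval (R := B) θ)
  surj : ∀ s ∈ A, ∃ p, Polynomial.aeval (R := B) θ p = s

lemma PStep.isPolyExt {B A : Subalgebra K S} {θ : S} (h : PStep B A θ) :
    letI := (Subalgebra.inclusion h.le).toAlgebra
    IsPolyExt B A (⟨θ, h.mem⟩ : A) := by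
  letI := (Subalgebra.inclusion h.le).toAlgebra
  haveI : IsScalarTower B A S := IsScalarTower.of_algebraMap_eq (fun x => rfl)
  have key : ∀ p : Polynomial B, ((Polynomial.aeval (R := B) (⟨θ, h.mem⟩ : A) p : A) : S)
      = Polynomial.aeval (R := B) θ p := by
    intro p
    have := Polynomial.aeval_algebraMap_apply (R := B) (A := A) S (⟨θ, h.mem⟩ : A) p
    exact this.symm
  constructor
  · intro p q hpq
    apply h.inj
    rw [← key, ← key, hpq]
  · rintro ⟨s, hs⟩
    obtain ⟨p, hp⟩ := h.surj s hs
    exact ⟨p, Subtype.ext (by rw [key, hp])⟩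

lemma PStep.isPolyExt_top {B A : Subalgebra K S} {θ : S} (h : PStep B A θ) (hA : A = ⊤) :
    IsPolyExt B S θ :=
  ⟨h.inj, fun s => h.surj s (by rw [hA]; trivial)⟩

/-- finite global dimension, Noetherian -/
def Good (A : Subalgebra K S) : Prop := IsNoetherianRing A ∧ ∃ d, GD A d

lemma GD_step {B A : Subalgebra K S} {θ : S} (h : PStep B A θ) {d : ℕ} (hd : GD B d) :
    GD A (d + 1) := by
  letI := (Subalgebra.inclusion h.le).toAlgebra
  exact GD.succ h.isPolyExt hd

lemma alphaS {B A : Subalgebra K S} {θ : S} (h : PStep B A θ) (hB : Good B) (I I' : Ideal S)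
    (hJ : Frob A S (I ⊓ I')) (hI : Module.Projective A (S ⧸ I))
    (hI' : Module.Projective A (S ⧸ I')) (hfin : Module.Finite B (S ⧸ (I ⊔ I'))) :
    Frob B S (I ⊔ I') := by
  letI := (Subalgebra.inclusion h.le).toAlgebra
  haveI : IsScalarTower B A S := IsScalarTower.of_algebraMap_eq (fun x => rfl)
  obtain ⟨_, d, hd⟩ := hB
  exact alpha h.isPolyExt hd I I' hJ hI hI' hfin

lemma exchangeS {B B' A : Subalgebra K S} {θ θ' : S} (h : PStep B A θ) (h' : PStep B' A θ')
    (hB' : Good B') (I : Ideal S) (hp : Module.Projective B (S ⧸ I))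
    (hf : Module.Finite B' (S ⧸ I)) : Module.Projective B' (S ⧸ I) := by
  letI := (Subalgebra.inclusion h.le).toAlgebra
  letI := (Subalgebra.inclusion h'.le).toAlgebra
  haveI : IsScalarTower B A S := IsScalarTower.of_algebraMap_eq (fun x => rfl)
  haveI : IsScalarTower B' A S := IsScalarTower.of_algebraMap_eq (fun x => rfl)
  haveI : IsScalarTower B A (S ⧸ I) := ⟨fun x y z => by
    obtain ⟨z, rfl⟩ := Ideal.Quotient.mk_surjective z
    exact congrArg (Ideal.Quotient.mk I) (smul_assoc x y z)⟩
  haveI : IsScalarTower B' A (S ⧸ I) := ⟨fun x y z => by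
    obtain ⟨z, rfl⟩ := Ideal.Quotient.mk_surjective z
    exact congrArg (Ideal.Quotient.mk I) (smul_assoc x y z)⟩
  obtain ⟨_, d, hd⟩ := hB'
  exact exchange h.isPolyExt h'.isPolyExt hd (S ⧸ I)

lemma pstep_insert {ι : Type*} {y : ι → S} (hy : AlgebraicIndependent K y) {s : Set ι} {i : ι}
    (hi : i ∉ s) :
    PStep (Algebra.adjoin K (y '' s)) (Algebra.adjoin K (y '' (insert i s))) (y i) := by
  have hle : Algebra.adjoin K (y '' s) ≤ Algebra.adjoin K (y '' (insert i s)) :=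
    Algebra.adjoin_mono (Set.image_mono (Set.subset_insert _ _))
  refine ⟨hle, Algebra.subset_adjoin ⟨i, Set.mem_insert _ _, rfl⟩, ?_, ?_⟩
  · exact transcendental_iff_injective.1 (hy.transcendental_adjoin hi)
  · intro x hx
    let R : Subalgebra K S :=
      ((Polynomial.aeval (R := Algebra.adjoin K (y '' s)) (y i)).restrictScalars K).range
    have : Algebra.adjoin K (y '' (insert i s)) ≤ R := by
      apply Algebra.adjoin_le
      rintro _ ⟨j, hj, rfl⟩
      rcases hj with rfl | hj
      · exact ⟨Polynomial.X, by simp⟩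
      · exact ⟨Polynomial.C ⟨y j, Algebra.subset_adjoin ⟨j, hj, rfl⟩⟩, by
          change Polynomial.aeval _ _ = _
          rw [Polynomial.aeval_C]; rfl⟩
    obtain ⟨p, hp⟩ := this hx
    exact ⟨p, hp⟩

lemma good_adjoin [Nontrivial S] {ι : Type*} [Finite ι] {y : ι → S} (hy : AlgebraicIndependent K y)
    (s : Set ι) : Good (Algebra.adjoin K (y '' s)) := by
  constructor
  · have hs : (y '' s).Finite := Set.toFinite _
    have h : (Algebra.adjoin K (y '' s)).FG := Subalgebra.fg_def.2 ⟨_, hs, rfl⟩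
    haveI := (Subalgebra.fg_iff_finiteType _).1 h
    exact Algebra.FiniteType.isNoetherianRing K _
  · induction s, Set.toFinite s using Set.Finite.induction_on with
    | empty =>
      refine ⟨0, GD_of_isField _ ?_⟩
      rw [Set.image_empty, Algebra.adjoin_empty]
      exact MulEquiv.isField (Field.toIsField K) (Algebra.botEquiv K S).toMulEquiv
    | @insert i s hi _ ih =>
      obtain ⟨d, hd⟩ := ih
      exact ⟨d + 1, GD_step (pstep_insert hy hi) hd⟩

lemma finite_inf {A : Subalgebra K S} (hA : Good A) (I I' : Ideal S)
    (h : Module.Finite A (S ⧸ I)) (h' : Module.Finite A (S ⧸ I')) :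
    Module.Finite A (S ⧸ (I ⊓ I')) := by
  haveI := hA.1
  let f : (S ⧸ (I ⊓ I')) →ₗ[S] (S ⧸ I) × (S ⧸ I') :=
    (Submodule.mapQ (I ⊓ I') I LinearMap.id inf_le_left).prod
      (Submodule.mapQ (I ⊓ I') I' LinearMap.id inf_le_right)
  have hf : Function.Injective f := by
    rw [← LinearMap.ker_eq_bot, LinearMap.ker_eq_bot']
    intro x hx
    obtain ⟨x, rfl⟩ := Submodule.mkQ_surjective _ x
    have h1 : (Submodule.Quotient.mk x : S ⧸ I) = 0 := congrArg Prod.fst hx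
    have h2 : (Submodule.Quotient.mk x : S ⧸ I') = 0 := congrArg Prod.snd hx
    rw [Submodule.Quotient.mk_eq_zero] at h1 h2
    exact (Submodule.Quotient.mk_eq_zero _).2 ⟨h1, h2⟩
  exact Module.Finite.of_injective (f.restrictScalars A) hf

end

end HK

namespace HK

open MvPolynomial

section
variable {K : Type u} [Field K] {n : ℕ}

attribute [local instance] MvPolynomial.gradedAlgebra

lemma fg_core (A : Subalgebra K (MvPolynomial (Fin n) K)) (J : Ideal (MvPolynomial (Fin n) K))
    (hJ : J.IsHomogeneous (homogeneousSubmodule (Fin n) K)) (Θ : Set (MvPolynomial (Fin n) K))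
    (hΘ : ∀ θ ∈ Θ, θ ∈ A ∧ θ.IsHomogeneous 1)
    (hP : ∀ P : Ideal (MvPolynomial (Fin n) K), P.IsPrime → J ≤ P → Θ ⊆ P → ∀ k, X k ∈ P) :
    Module.Finite A (MvPolynomial (Fin n) K ⧸ J) := by
  have hrad : idealOfVars (Fin n) K ≤ (J ⊔ Ideal.span Θ).radical := by
    refine Ideal.span_le.2 ?_
    rintro _ ⟨k, rfl⟩
    rw [SetLike.mem_coe, Ideal.radical_eq_sInf, Submodule.mem_sInf]
    rintro P ⟨h1, h2⟩
    exact hP P h2 (le_sup_left.trans h1) (Ideal.span_le.1 (le_sup_right.trans h1)) k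
  obtain ⟨D, hD⟩ := Ideal.exists_pow_le_of_le_radical_of_fg hrad (idealOfVars_fg (Fin n) K)
  let mons : Set (MvPolynomial (Fin n) K) :=
    (fun d : Fin n →₀ ℕ => monomial d (1 : K)) '' {d | d.degree < D + 1}
  have hmons : mons.Finite := (Finsupp.finite_of_degree_lt (D + 1)).image _
  let G : Submodule A (MvPolynomial (Fin n) K) := Submodule.span A mons
  let N : Submodule A (MvPolynomial (Fin n) K) := J.restrictScalars A ⊔ G
  have key : ∀ d : ℕ, ∀ f : MvPolynomial (Fin n) K, f.IsHomogeneous d → f ∈ N := by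
    intro d
    induction d with
    | zero =>
      intro f hf
      refine Submodule.mem_sup_right ?_
      rw [f.as_sum]
      refine Submodule.sum_mem _ fun v hv => ?_
      have hv' : v.degree = 0 := hf.degree_eq_sum_deg_support hv |> fun h => h.symm
      have h2 : monomial v (1 : K) ∈ G := Submodule.subset_span ⟨v, by simp [hv'], rfl⟩
      have h3 := G.smul_mem (algebraMap K A (coeff v f)) h2
      rwa [algebraMap_smul, smul_monomial, smul_eq_mul, mul_one] at h3
    | succ e ih =>
      intro f hf
      by_cases he : e + 1 < D + 1
      · refine Submodule.mem_sup_right ?_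
        rw [f.as_sum]
        refine Submodule.sum_mem _ fun v hv => ?_
        have hv' : v.degree = e + 1 := hf.degree_eq_sum_deg_support hv |> fun h => h.symm
        have h2 : monomial v (1 : K) ∈ G := Submodule.subset_span ⟨v, by
          simp only [Set.mem_ofPred_eq]; omega, rfl⟩
        have h3 := G.smul_mem (algebraMap K A (coeff v f)) h2
        rwa [algebraMap_smul, smul_monomial, smul_eq_mul, mul_one] at h3
      · have hfm : f ∈ J ⊔ Ideal.span Θ := by
          apply hD
          rw [mem_pow_idealOfVars_iff]
          intro v hv
          have hv' : v.degree = e + 1 := hf.degree_eq_sum_deg_support hv |> fun h => h.symm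
          omega
        obtain ⟨j, hj, g, hg, rfl⟩ := Submodule.mem_sup.1 hfm
        have h1 : (DirectSum.decompose (homogeneousSubmodule (Fin n) K) (j + g) (1 + e) :
            MvPolynomial (Fin n) K) = j + g := by
          rw [add_comm 1 e]
          exact DirectSum.decompose_of_mem_same _ hf
        rw [← h1, DirectSum.decompose_add]
        refine N.add_mem (Submodule.mem_sup_left (hJ (1 + e) hj)) ?_
        have h2 : ∀ r : MvPolynomial (Fin n) K,
            (DirectSum.decompose (homogeneousSubmodule (Fin n) K) (r * g) (1 + e) :
            MvPolynomial (Fin n) K) ∈ N := by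
          refine Submodule.span_induction (p := fun g _ => ∀ r : MvPolynomial (Fin n) K,
            (DirectSum.decompose (homogeneousSubmodule (Fin n) K) (r * g) (1 + e) :
            MvPolynomial (Fin n) K) ∈ N) ?_ ?_ ?_ ?_ hg
          · intro θ hθ r
            rw [mul_comm, DirectSum.coe_decompose_mul_add_of_left_mem _ (hΘ θ hθ).2]
            have h3 := ih _ (DirectSum.decompose (homogeneousSubmodule (Fin n) K) r e).2
            exact N.smul_mem (⟨θ, (hΘ θ hθ).1⟩ : A) h3
          · intro r
            rw [mul_zero, DirectSum.decompose_zero]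
            exact N.zero_mem
          · intro x y _ _ hx hy r
            rw [mul_add, DirectSum.decompose_add]
            exact N.add_mem (hx r) (hy r)
          · intro s x _ hx r
            rw [smul_eq_mul, ← mul_assoc]
            exact hx _
        simpa using h2 1
  have htop : ∀ f : MvPolynomial (Fin n) K, f ∈ N := by
    intro f
    rw [← sum_homogeneousComponent f]
    exact N.sum_mem fun i _ => key i _ (homogeneousComponent_isHomogeneous i f)
  haveI : Module.Finite A G := Module.Finite.span_of_finite A hmons
  refine Module.Finite.of_surjective
    (((Submodule.mkQ J).restrictScalars A).comp G.subtype) ?_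
  intro x
  obtain ⟨x, rfl⟩ := Submodule.mkQ_surjective _ x
  obtain ⟨j, hj, g, hg, rfl⟩ := Submodule.mem_sup.1 (htop x)
  refine ⟨⟨g, hg⟩, ?_⟩
  change (Submodule.Quotient.mk g : _ ⧸ J) = Submodule.Quotient.mk (j + g)
  rw [Submodule.Quotient.eq]
  have : g - (j + g) = -j := by ring
  rw [this]
  exact J.neg_mem hj

lemma xv_hom (k : ℕ) : (xv K n k).IsHomogeneous 1 := by
  unfold xv
  split_ifs
  · exact isHomogeneous_X _ _
  · exact isHomogeneous_zero _ _ _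

lemma DD_hom (s : ℕ) (c : ℕ → ℕ) : (DD K n s c).IsHomogeneous s := by
  unfold DD
  rw [Matrix.det_apply]
  refine IsHomogeneous.sum _ _ _ fun σ _ => ?_
  have h : (∏ i : Fin s, (Matrix.of fun i j : Fin s =>
      xv K n (c i / 2 + (c j + 1) / 2)) (σ i) i).IsHomogeneous (∑ i : Fin s, 1) :=
    IsHomogeneous.prod _ _ _ fun i _ => xv_hom _
  rw [Finset.sum_const, Finset.card_univ, Fintype.card_fin, smul_eq_mul, mul_one] at h
  rcases Int.units_eq_one_or (Equiv.Perm.sign σ) with h1 | h1 <;> rw [h1]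
  · rwa [one_smul]
  · rw [Units.neg_smul, one_smul]
    exact h.neg

lemma qq_hom {a b s : ℕ} (hb : b ≤ n) :
    (qq K n a b s).IsHomogeneous (homogeneousSubmodule (Fin n) K) := by
  rw [qq_eq_span hb]
  apply Ideal.homogeneous_span
  rintro _ ⟨c, _, rfl⟩
  exact ⟨s, DD_hom s c⟩

/-- antitriangular determinants -/
lemma anti_left {R : Type*} [CommRing R] [IsDomain R] {r : ℕ} (M : Matrix (Fin (r + 1)) (Fin (r + 1)) R)
    (x : R) (h0 : ∀ i j : Fin (r + 1), (i : ℕ) + j < r → M i j = 0)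
    (h1 : ∀ i j : Fin (r + 1), (i : ℕ) + j = r → M i j = x) (hdet : M.det = 0) : x = 0 := by
  have h2 := Matrix.det_permute' (Fin.revPerm (n := r + 1)) M
  rw [hdet, mul_zero, Matrix.det_of_isLowerTriangular] at h2
  · have h3 : ∀ i, (M.submatrix id (Fin.revPerm (n := r + 1))) i i = x := by
      intro i
      apply h1
      simp [Fin.val_rev]
      omega
    rw [Finset.prod_congr rfl (fun i _ => h3 i)] at h2
    simp at h2
    exact h2
  · intro i j hij
    apply h0
    have : (i : ℕ) < j := hij
    simp [Fin.val_rev]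
    omega

lemma anti_right {R : Type*} [CommRing R] [IsDomain R] {r : ℕ} (M : Matrix (Fin (r + 1)) (Fin (r + 1)) R)
    (x : R) (h0 : ∀ i j : Fin (r + 1), r < (i : ℕ) + j → M i j = 0)
    (h1 : ∀ i j : Fin (r + 1), (i : ℕ) + j = r → M i j = x) (hdet : M.det = 0) : x = 0 := by
  have h2 := Matrix.det_permute' (Fin.revPerm (n := r + 1)) M
  rw [hdet, mul_zero, Matrix.det_of_isUpperTriangular] at h2
  · have h3 : ∀ i, (M.submatrix id (Fin.revPerm (n := r + 1))) i i = x := by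
      intro i
      apply h1
      simp [Fin.val_rev]
      omega
    rw [Finset.prod_congr rfl (fun i _ => h3 i)] at h2
    simp at h2
    exact h2
  · intro i j hij
    apply h0
    have : (j : ℕ) < i := hij
    simp [Fin.val_rev]
    omega

lemma win_det {a b r k : ℕ} (hb : b ≤ n) (P : Ideal (MvPolynomial (Fin n) K))
    (hq : qq K n a b (r + 1) ≤ P) (h1 : a + r ≤ k) (h2 : k + r < b) :
    (Matrix.of fun i j : Fin (r + 1) => Ideal.Quotient.mk P (xv K n ((k - r + i) + j))).det = 0 := by
  have h := hq (det_mem_qq (K := K) (a := a) hb (fun i : Fin (r + 1) => k - r + i)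
    (fun j : Fin (r + 1) => (j : ℕ)) (fun i j => by have := i.2; have := j.2; omega))
  rw [← Ideal.Quotient.eq_zero_iff_mem, RingHom.map_det] at h
  exact h

lemma fill_left {a b r : ℕ} (hb : b ≤ n) (P : Ideal (MvPolynomial (Fin n) K)) [P.IsPrime]
    (hq : qq K n a b (r + 1) ≤ P) (h0 : ∀ k < a + r, xv K n k ∈ P) :
    ∀ k, k + r < b → xv K n k ∈ P := by
  intro k
  induction k using Nat.strong_induction_on with
  | _ k ih =>
    intro hk
    by_cases h : k < a + r
    · exact h0 k h
    rw [← Ideal.Quotient.eq_zero_iff_mem]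
    refine anti_left _ _ ?_ ?_ (win_det hb P hq (by omega : a + r ≤ k) hk)
    · intro i j hij
      rw [Matrix.of_apply, Ideal.Quotient.eq_zero_iff_mem]
      exact ih _ (by omega) (by omega)
    · intro i j hij
      rw [Matrix.of_apply]
      congr 2
      omega

lemma fill_right {a b r : ℕ} (hb : b ≤ n) (P : Ideal (MvPolynomial (Fin n) K)) [P.IsPrime]
    (hq : qq K n a b (r + 1) ≤ P) (h0 : ∀ k, b ≤ k + r → xv K n k ∈ P) :
    ∀ k, a + r ≤ k → xv K n k ∈ P := by
  have key : ∀ d k, k + d = b → a + r ≤ k → xv K n k ∈ P := by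
    intro d
    induction d using Nat.strong_induction_on with
    | _ d ih =>
      intro k hkd hk
      by_cases h : b ≤ k + r
      · exact h0 k h
      rw [← Ideal.Quotient.eq_zero_iff_mem]
      refine anti_right _ _ ?_ ?_ (win_det hb P hq hk (by omega))
      · intro i j hij
        rw [Matrix.of_apply, Ideal.Quotient.eq_zero_iff_mem]
        by_cases h3 : b ≤ (k - r + i + j) + r
        · exact h0 _ h3
        · exact ih (b - (k - r + i + j)) (by omega) _ (by omega) (by omega)
      · intro i j hij
        rw [Matrix.of_apply]
        congr 2
        omega
  intro k hk
  by_cases h : b ≤ k + r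
  · exact h0 k h
  · exact key (b - k) k (by omega) hk

end

end HK

namespace HK

open MvPolynomial

/-- variables outside a window -/
def Ts (n a b : ℕ) : Set (Fin n) := {i | (i : ℕ) < a ∨ b ≤ (i : ℕ)}

lemma mem_Ts {n a b : ℕ} (i : Fin n) : i ∈ Ts n a b ↔ (i : ℕ) < a ∨ b ≤ (i : ℕ) := Iff.rfl

/-- the polynomial subring on the variables outside a window -/
noncomputable def TT (K : Type u) [Field K] (n a b : ℕ) : Subalgebra K (MvPolynomial (Fin n) K) :=
  Algebra.adjoin K ((X : Fin n → MvPolynomial (Fin n) K) '' Ts n a b)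

/-- changed coordinates -/
noncomputable def yv (K : Type u) [Field K] (n a b : ℕ) (i : Fin n) : MvPolynomial (Fin n) K :=
  if (i : ℕ) = a then X i - xv K n (b - 1) else X i

/-- the intermediate polynomial subring -/
noncomputable def TP (K : Type u) [Field K] (n a b : ℕ) : Subalgebra K (MvPolynomial (Fin n) K) :=
  Algebra.adjoin K (yv K n a b '' Ts n (a + 1) b)

section
variable {K : Type u} [Field K] {n : ℕ}

lemma yv_alg {a b : ℕ} (h : a + 2 ≤ b) (hb : b ≤ n) : AlgebraicIndependent K (yv K n a b) := by
  let ψ : MvPolynomial (Fin n) K →ₐ[K] MvPolynomial (Fin n) K :=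
    aeval (fun i : Fin n => if (i : ℕ) = a then X i + xv K n (b - 1) else X i)
  have h1 : ψ.comp (aeval (yv K n a b)) = AlgHom.id K _ := by
    ext1 i
    have h2 : ψ (xv K n (b - 1)) = xv K n (b - 1) := by
      rw [xv_of_lt (by omega : b - 1 < n)]
      simp only [ψ, aeval_X]
      rw [if_neg (by omega)]
    rw [AlgHom.comp_apply, aeval_X, AlgHom.id_apply]
    unfold yv
    split_ifs with hi
    · rw [map_sub, h2]
      simp only [ψ, aeval_X]
      rw [if_pos hi]
      ring
    · simp only [ψ, aeval_X]
      rw [if_neg hi]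
  have h3 : Function.LeftInverse ψ (aeval (R := K) (yv K n a b)) := fun x => by
    rw [← AlgHom.comp_apply, h1, AlgHom.id_apply]
  exact h3.injective

lemma good_TT (a b : ℕ) : Good (TT K n a b) := good_adjoin (algebraicIndependent_X _ _) _

lemma good_TP {a b : ℕ} (h : a + 2 ≤ b) (hb : b ≤ n) : Good (TP K n a b) :=
  good_adjoin (yv_alg h hb) _

lemma TT_top {a b : ℕ} (h : b ≤ a) : TT K n a b = ⊤ := by
  unfold TT
  have : Ts n a b = Set.univ := by
    ext i
    rw [mem_Ts]
    simp only [Set.mem_univ, iff_true]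
    omega
  rw [this, Set.image_univ, adjoin_range_X]

lemma step_left {a b : ℕ} (h : a < b) (hb : b ≤ n) :
    PStep (TT K n a b) (TT K n (a + 1) b) (X ⟨a, by omega⟩) := by
  have h1 := pstep_insert (algebraicIndependent_X (Fin n) K) (s := Ts n a b)
    (i := ⟨a, by omega⟩) (by rw [mem_Ts]; dsimp only; omega)
  have : insert (⟨a, by omega⟩ : Fin n) (Ts n a b) = Ts n (a + 1) b := by
    ext i
    rw [Set.mem_insert_iff, mem_Ts, mem_Ts, Fin.ext_iff]
    dsimp only
    omega
  rw [this] at h1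
  exact h1

lemma step_right {a b : ℕ} (h : a < b) (hb : b ≤ n) :
    PStep (TT K n a b) (TT K n a (b - 1)) (X ⟨b - 1, by omega⟩) := by
  have h1 := pstep_insert (algebraicIndependent_X (Fin n) K) (s := Ts n a b)
    (i := ⟨b - 1, by omega⟩) (by rw [mem_Ts]; dsimp only; omega)
  have : insert (⟨b - 1, by omega⟩ : Fin n) (Ts n a b) = Ts n a (b - 1) := by
    ext i
    rw [Set.mem_insert_iff, mem_Ts, mem_Ts, Fin.ext_iff]
    dsimp only
    omega
  rw [this] at h1
  exact h1

lemma step_P {a b : ℕ} (h : a + 2 ≤ b) (hb : b ≤ n) :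
    PStep (TT K n a b) (TP K n a b) (yv K n a b ⟨a, by omega⟩) := by
  have h1 := pstep_insert (yv_alg (K := K) h hb) (s := Ts n a b)
    (i := ⟨a, by omega⟩) (by rw [mem_Ts]; dsimp only; omega)
  have e1 : insert (⟨a, by omega⟩ : Fin n) (Ts n a b) = Ts n (a + 1) b := by

    ext i
    rw [Set.mem_insert_iff, mem_Ts, mem_Ts, Fin.ext_iff]
    dsimp only
    omega
  have e2 : yv K n a b '' Ts n a b = X '' Ts n a b := by
    apply Set.image_congr
    intro i hi
    rw [mem_Ts] at hi
    exact if_neg (by omega)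
  rw [e1, e2] at h1
  exact h1

lemma step_Q {a b : ℕ} (h : a + 2 ≤ b) (hb : b ≤ n) :
    PStep (TP K n a b) (TT K n (a + 1) (b - 1)) (yv K n a b ⟨b - 1, by omega⟩) := by
  have h1 := pstep_insert (yv_alg (K := K) h hb) (s := Ts n (a + 1) b)
    (i := ⟨b - 1, by omega⟩) (by rw [mem_Ts]; dsimp only; omega)
  have e1 : insert (⟨b - 1, by omega⟩ : Fin n) (Ts n (a + 1) b) = Ts n (a + 1) (b - 1) := by
    ext i
    rw [Set.mem_insert_iff, mem_Ts, mem_Ts, Fin.ext_iff]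
    dsimp only
    omega
  have e2 : Algebra.adjoin K (yv K n a b '' Ts n (a + 1) (b - 1)) = TT K n (a + 1) (b - 1) := by
    have hbm : ∀ f : Fin n → MvPolynomial (Fin n) K, f ⟨b - 1, by omega⟩ ∈
        f '' Ts n (a + 1) (b - 1) := fun f => ⟨_, by rw [mem_Ts]; dsimp only; omega, rfl⟩
    have hyb : yv K n a b ⟨b - 1, by omega⟩ = xv K n (b - 1) := by
      rw [xv_of_lt (by omega : b - 1 < n)]
      exact if_neg (by dsimp only; omega)
    apply le_antisymm
    · apply Algebra.adjoin_le
      rintro _ ⟨i, hi, rfl⟩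
      unfold yv
      split_ifs with hia
      · apply Subalgebra.sub_mem
        · exact Algebra.subset_adjoin ⟨i, hi, rfl⟩
        · rw [xv_of_lt (by omega : b - 1 < n)]
          exact Algebra.subset_adjoin (hbm X)
      · exact Algebra.subset_adjoin ⟨i, hi, rfl⟩
    · apply Algebra.adjoin_le
      rintro _ ⟨i, hi, rfl⟩
      have h2 : yv K n a b i ∈ Algebra.adjoin K (yv K n a b '' Ts n (a + 1) (b - 1)) :=
        Algebra.subset_adjoin ⟨i, hi, rfl⟩
      by_cases hia : (i : ℕ) = a
      · have h3 : yv K n a b i = X i - xv K n (b - 1) := if_pos hia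
        have h4 : (X i : MvPolynomial (Fin n) K) = yv K n a b i + xv K n (b - 1) := by
          rw [h3]; ring
        rw [SetLike.mem_coe, h4]
        apply Subalgebra.add_mem _ h2
        rw [← hyb]
        exact Algebra.subset_adjoin (hbm _)
      · have h3 : yv K n a b i = X i := if_neg hia
        rwa [h3] at h2
  rw [e1, e2] at h1
  exact h1

lemma fin_TT {a b r : ℕ} (h : a + 2 * r + 1 ≤ b) (hb : b ≤ n) :
    Module.Finite (TT K n (a + r) (b - r)) (MvPolynomial (Fin n) K ⧸ qq K n a b (r + 1)) := by
  refine fg_core _ _ (qq_hom hb) (X '' Ts n (a + r) (b - r)) ?_ ?_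
  · rintro _ ⟨i, hi, rfl⟩
    exact ⟨Algebra.subset_adjoin ⟨i, hi, rfl⟩, isHomogeneous_X _ _⟩
  · intro P hP hq hΘ k
    by_cases hk : k ∈ Ts n (a + r) (b - r)
    · exact hΘ ⟨k, hk, rfl⟩
    · rw [mem_Ts] at hk
      have h1 := fill_left hb P hq (fun j hj => by
        rw [xv_of_lt (by omega : j < n)]
        exact hΘ ⟨_, Or.inl hj, rfl⟩) k (by omega)
      rwa [xv_of_lt k.2] at h1

lemma yv_hom (a b : ℕ) (i : Fin n) : (yv K n a b i).IsHomogeneous 1 := by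
  unfold yv
  split_ifs
  · exact (isHomogeneous_X _ _).sub (xv_hom _)
  · exact isHomogeneous_X _ _

lemma fin_TP_aux {a b : ℕ} (h : a + 2 ≤ b) (hb : b ≤ n) {s : ℕ} {a' b' : ℕ} (hb' : b' ≤ n)
    (hP : ∀ P : Ideal (MvPolynomial (Fin n) K), P.IsPrime → qq K n a' b' s ≤ P →
      (∀ k, k < a ∨ b ≤ k → xv K n k ∈ P) → xv K n a - xv K n (b - 1) ∈ P →
      ∀ k, xv K n k ∈ P) :
    Module.Finite (TP K n a b) (MvPolynomial (Fin n) K ⧸ qq K n a' b' s) := by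
  refine fg_core _ _ (qq_hom hb') (yv K n a b '' Ts n (a + 1) b) ?_ ?_
  · rintro _ ⟨i, hi, rfl⟩
    exact ⟨Algebra.subset_adjoin ⟨i, hi, rfl⟩, yv_hom _ _ _⟩
  · intro P hPp hq hΘ k
    have h1 := hP P hPp hq ?_ ?_ k
    · rwa [xv_of_lt k.2] at h1
    · intro k hk
      by_cases hkn : k < n
      · rw [xv_of_lt hkn]
        have : yv K n a b ⟨k, hkn⟩ = X ⟨k, hkn⟩ := if_neg (by dsimp only; omega)
        rw [← this]
        exact hΘ ⟨_, by change k < a + 1 ∨ b ≤ k; omega, rfl⟩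
      · unfold xv
        rw [dif_neg hkn]
        exact P.zero_mem
    · have : yv K n a b ⟨a, by omega⟩ = xv K n a - xv K n (b - 1) := by
        rw [xv_of_lt (by omega : a < n)]
        exact if_pos rfl
      rw [← this]
      exact hΘ ⟨_, by change a < a + 1 ∨ b ≤ a; omega, rfl⟩

lemma fin_TP_l {a b r : ℕ} (h : a + 2 * r + 2 ≤ b) (hb : b ≤ n) :
    Module.Finite (TP K n (a + r) (b - r))
      (MvPolynomial (Fin n) K ⧸ qq K n a (b - 1) (r + 1)) := by
  refine fin_TP_aux (by omega) (by omega) (by omega) ?_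
  intro P hP hq h0 h1
  have h2 := fill_left (by omega) P hq (fun k hk => h0 k (Or.inl hk))
  intro k
  by_cases hk : k + r < b - 1
  · exact h2 k hk
  by_cases hk2 : b - r ≤ k
  · exact h0 k (Or.inr hk2)
  · have : k = b - r - 1 := by omega
    rw [this]
    have h3 := P.sub_mem (h2 (a + r) (by omega)) h1
    simpa using h3

lemma fin_TP_r {a b r : ℕ} (h : a + 2 * r + 2 ≤ b) (hb : b ≤ n) :
    Module.Finite (TP K n (a + r) (b - r))
      (MvPolynomial (Fin n) K ⧸ qq K n (a + 1) b (r + 1)) := by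
  refine fin_TP_aux (by omega) (by omega) (by omega) ?_
  intro P hP hq h0 h1
  have h2 := fill_right (by omega) P hq (fun k hk => h0 k (Or.inr (by omega)))
  intro k
  by_cases hk : a + 1 + r ≤ k
  · exact h2 k hk
  by_cases hk2 : k < a + r
  · exact h0 k (Or.inl hk2)
  · have : k = a + r := by omega
    rw [this]
    have h3 := P.add_mem h1 (h2 (b - r - 1) (by omega))
    simpa using h3

end

end HK

namespace HK

open MvPolynomial

section
variable {K : Type u} [Field K] {n : ℕ}

lemma principal_qq {a r : ℕ} (hb : a + 2 * r + 1 ≤ n) :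
    ∃ f : MvPolynomial (Fin n) K, f ≠ 0 ∧ qq K n a (a + 2 * r + 1) (r + 1) = Ideal.span {f} := by
  have hc : IsChain2 (r + 1) a (a + 2 * r + 1) (fun k => a + 2 * k) := chain_left (by omega)
  refine ⟨_, DD_ne_zero hc hb, ?_⟩
  rw [qq_eq_span hb]
  congr 1
  ext f
  constructor
  · rintro ⟨c, hc', rfl⟩
    have h1 : ∀ k, k < r + 1 → a + 2 * k ≤ c k := by
      intro k
      induction k with
      | zero => intro h; have := (hc'.1 0 h).1; omega
      | succ k ih => intro h; have := hc'.2 k h; have := ih (by omega); omega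
    have h2 : ∀ d k, k + d = r → c k ≤ a + 2 * k := by
      intro d
      induction d with
      | zero => intro k hk; have := (hc'.1 k (by omega)).2; omega
      | succ d ih =>
        intro k hk
        have := hc'.2 k (by omega)
        have := ih (k + 1) (by omega)
        omega
    have h3 : ∀ k : Fin (r + 1), c k = a + 2 * k := fun k =>
      le_antisymm (h2 (r - k) k (by omega)) (h1 k k.2)
    rw [Set.mem_singleton_iff]
    unfold DD
    congr 1
    ext1 i j
    simp only [Matrix.of_apply, h3]
  · intro hf
    exact ⟨_, hc, hf⟩

lemma inf_principal {S : Type*} [CommRing S] [IsDomain S] {f g : S}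
    (hp : (Ideal.span {f}).IsPrime) (hn : ¬ Ideal.span {g} ≤ Ideal.span {f}) :
    Ideal.span {f} ⊓ Ideal.span {g} = Ideal.span {f * g} := by
  apply le_antisymm
  · rintro x ⟨h1, h2⟩
    obtain ⟨y, rfl⟩ := Ideal.mem_span_singleton'.1 h2
    have hg : g ∉ Ideal.span {f} := fun h => hn (by
      rw [Ideal.span_le, Set.singleton_subset_iff]; exact h)
    have hy := (hp.mem_or_mem h1).resolve_right hg
    obtain ⟨z, rfl⟩ := Ideal.mem_span_singleton'.1 hy
    exact Ideal.mem_span_singleton'.2 ⟨z, by ring⟩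
  · rw [Ideal.span_le, Set.singleton_subset_iff]
    exact ⟨Ideal.mem_span_singleton'.2 ⟨g, by ring⟩, Ideal.mem_span_singleton'.2 ⟨f, by ring⟩⟩

lemma frob_base {B A : Subalgebra K (MvPolynomial (Fin n) K)} {θ : MvPolynomial (Fin n) K}
    (h : PStep B A θ) (hA : A = ⊤) (hB : Good B) {f : MvPolynomial (Fin n) K} (hf : f ≠ 0)
    (I : Ideal (MvPolynomial (Fin n) K)) (hI : I = Ideal.span {f})
    (hfin : Module.Finite B (MvPolynomial (Fin n) K ⧸ I)) :
    Frob B (MvPolynomial (Fin n) K) I := by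
  obtain ⟨_, d, hd⟩ := hB
  subst hI
  exact frob_principal (h.isPolyExt_top hA) hd f hf hfin

/-- the even ideals -/
noncomputable def EJ (K : Type u) [Field K] (n a b r : ℕ) : Ideal (MvPolynomial (Fin n) K) :=
  qq K n a b (r + 1) ⊓ qq K n (a + 1) (b - 1) r

/-- the odd ideals -/
noncomputable def OJ (K : Type u) [Field K] (n a b r : ℕ) : Ideal (MvPolynomial (Fin n) K) :=
  qq K n a (b - 1) (r + 1) ⊓ qq K n (a + 1) b (r + 1)

lemma fin_top (A : Subalgebra K (MvPolynomial (Fin n) K)) :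
    Module.Finite A (MvPolynomial (Fin n) K ⧸ (⊤ : Ideal (MvPolynomial (Fin n) K))) :=
  ⟨⟨∅, Subsingleton.elim _ _⟩⟩

lemma fin_TT' {a b r : ℕ} (h : a + 2 * r + 1 ≤ b) (hb : b ≤ n) :
    Module.Finite (TT K n (a + r) (b - r))
      (MvPolynomial (Fin n) K ⧸ qq K n (a + 1) (b - 1) r) := by
  cases r with
  | zero => rw [qq_zero]; exact fin_top _
  | succ r =>
    have h1 := fin_TT (K := K) (n := n) (a := a + 1) (b := b - 1) (r := r) (by omega) (by omega)
    have e1 : a + 1 + r = a + (r + 1) := by omega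
    have e2 : b - 1 - r = b - (r + 1) := by omega
    rwa [e1, e2] at h1

lemma fin_EJ {a b r : ℕ} (h : a + 2 * r + 1 ≤ b) (hb : b ≤ n) :
    Module.Finite (TT K n (a + r) (b - r)) (MvPolynomial (Fin n) K ⧸ EJ K n a b r) :=
  finite_inf (good_TT _ _) _ _ (fin_TT h hb) (fin_TT' h hb)

lemma fin_OJ {a b r : ℕ} (h : a + 2 * r + 2 ≤ b) (hb : b ≤ n) :
    Module.Finite (TP K n (a + r) (b - r)) (MvPolynomial (Fin n) K ⧸ OJ K n a b r) :=
  finite_inf (good_TP (by omega) (by omega)) _ _ (fin_TP_l h hb) (fin_TP_r h hb)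

lemma even_base {a b r : ℕ} (h : b = a + 2 * r + 1) (hb : b ≤ n) :
    Frob (TT K n (a + r) (b - r)) (MvPolynomial (Fin n) K) (EJ K n a b r) := by
  have hs := step_left (K := K) (n := n) (a := a + r) (b := b - r) (by omega) (by omega)
  have ht : TT K n (a + r + 1) (b - r) = ⊤ := TT_top (by omega)
  obtain ⟨f, hf, hf'⟩ := principal_qq (K := K) (n := n) (a := a) (r := r) (by omega)
  rw [← h] at hf'
  cases r with
  | zero =>
    refine frob_base hs ht (good_TT _ _) hf _ ?_ (fin_EJ (by omega) hb)
    rw [EJ, qq_zero, inf_top_eq, hf']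
  | succ r =>
    obtain ⟨g, hg, hg'⟩ := principal_qq (K := K) (n := n) (a := a + 1) (r := r) (by omega)
    have e1 : a + 1 + 2 * r + 1 = b - 1 := by omega
    rw [e1] at hg'
    refine frob_base hs ht (good_TT _ _) (mul_ne_zero hf hg) _ ?_ (fin_EJ (by omega) hb)
    have hp := qq_prime (K := K) (n := n) a b (r + 1)
    have hn : ¬ qq K n (a + 1) (b - 1) (r + 1) ≤ qq K n a b (r + 1 + 1) :=
      not_le_len (by omega) hb (by omega) (by omega)
    rw [hf'] at hp hn
    rw [hg'] at hn
    rw [EJ, hf', hg', inf_principal hp hn]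

lemma odd_base {a b r : ℕ} (h : b = a + 2 * r + 2) (hb : b ≤ n) :
    Frob (TP K n (a + r) (b - r)) (MvPolynomial (Fin n) K) (OJ K n a b r) := by
  have hs := step_Q (K := K) (n := n) (a := a + r) (b := b - r) (by omega) (by omega)
  have ht : TT K n (a + r + 1) (b - r - 1) = ⊤ := TT_top (by omega)
  obtain ⟨f, hf, hf'⟩ := principal_qq (K := K) (n := n) (a := a) (r := r) (by omega)
  obtain ⟨g, hg, hg'⟩ := principal_qq (K := K) (n := n) (a := a + 1) (r := r) (by omega)
  have e1 : a + 1 + 2 * r + 1 = b := by omega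
  have e2 : a + 2 * r + 1 = b - 1 := by omega
  rw [e1] at hg'
  rw [e2] at hf'
  refine frob_base hs ht (good_TP (by omega) (by omega)) (mul_ne_zero hf hg) _ ?_
    (fin_OJ (by omega) hb)
  have hp := qq_prime (K := K) (n := n) a (b - 1) r
  have hn : ¬ qq K n (a + 1) b (r + 1) ≤ qq K n a (b - 1) (r + 1) :=
    not_le_right hb (by omega) (by omega)
  rw [hf'] at hp hn
  rw [hg'] at hn
  rw [OJ, hf', hg', inf_principal hp hn]

/-- projectivity hypothesis for windows of length `l` -/
def PL (K : Type u) [Field K] (n l : ℕ) : Prop :=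
  ∀ a b r, b = a + l → b ≤ n → 2 * r + 1 ≤ l →
    Module.Projective (TT K n (a + r) (b - r)) (MvPolynomial (Fin n) K ⧸ qq K n a b (r + 1))

lemma beta_even {a b r : ℕ} (h : a + 2 * r + 1 ≤ b) (hb : b ≤ n)
    (hIH : 1 ≤ r → PL K n (b - a - 2))
    (hE : Frob (TT K n (a + r) (b - r)) (MvPolynomial (Fin n) K) (EJ K n a b r)) :
    Module.Projective (TT K n (a + r) (b - r)) (MvPolynomial (Fin n) K ⧸ qq K n a b (r + 1)) := by
  haveI := qq_prime (K := K) (n := n) a b r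
  refine beta _ _ hE ?_ ?_
  · cases r with
    | zero =>
      rw [qq_zero]
      infer_instance
    | succ r =>
      have h1 := hIH (by omega) (a + 1) (b - 1) r (by omega) (by omega) (by omega)
      have e1 : a + 1 + r = a + (r + 1) := by omega
      have e2 : b - 1 - r = b - (r + 1) := by omega
      rwa [e1, e2] at h1
  · exact not_le_len (by omega) hb (by omega) (by omega)

lemma odd_to_even {a b r : ℕ} (h : a + 2 * r + 2 ≤ b) (hb : b ≤ n) (hIH : PL K n (b - a - 1))
    (hO : Frob (TP K n (a + r) (b - r)) (MvPolynomial (Fin n) K) (OJ K n a b r)) :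
    Frob (TT K n (a + r) (b - r)) (MvPolynomial (Fin n) K) (EJ K n a b r) := by
  have e := inf_eq2 (K := K) (n := n) (a := a) (b := b) (s := r) hb (by omega)
  have hfin := fin_EJ (K := K) (n := n) (a := a) (b := b) (r := r) (by omega) hb
  have hQ := step_Q (K := K) (n := n) (a := a + r) (b := b - r) (by omega) (by omega)
  have hG : Good (TP K n (a + r) (b - r)) := good_TP (by omega) (by omega)
  have p1 : Module.Projective (TP K n (a + r) (b - r))
      (MvPolynomial (Fin n) K ⧸ qq K n a (b - 1) (r + 1)) := by
    have h1 := hIH a (b - 1) r (by omega) (by omega) (by omega)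
    have e2 : b - 1 - r = b - r - 1 := by omega
    rw [e2] at h1
    exact exchangeS (step_left (by omega) (by omega)) hQ hG _ h1 (fin_TP_l h hb)
  have p2 : Module.Projective (TP K n (a + r) (b - r))
      (MvPolynomial (Fin n) K ⧸ qq K n (a + 1) b (r + 1)) := by
    have h1 := hIH (a + 1) b r (by omega) (by omega) (by omega)
    have e2 : a + 1 + r = a + r + 1 := by omega
    rw [e2] at h1
    exact exchangeS (step_right (by omega) (by omega)) hQ hG _ h1 (fin_TP_r h hb)
  unfold EJ at hfin ⊢
  rw [← e] at hfin ⊢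
  exact alphaS (step_P (by omega) (by omega)) (good_TT _ _) _ _ hO p1 p2 hfin

lemma even_to_odd {a b r : ℕ} (h : a + 2 * r + 3 ≤ b) (hb : b ≤ n) (hIH : PL K n (b - a - 2))
    (hE : Frob (TT K n (a + (r + 1)) (b - (r + 1))) (MvPolynomial (Fin n) K) (EJ K n a b (r + 1))) :
    Frob (TP K n (a + r) (b - r)) (MvPolynomial (Fin n) K) (OJ K n a b r) := by
  have e := inf_eq1 (K := K) (n := n) (a := a) (b := b) (s := r + 1) hb (by omega) (by omega)
  have hfin := fin_OJ (K := K) (n := n) (a := a) (b := b) (r := r) (by omega) hb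
  have hQ := step_Q (K := K) (n := n) (a := a + r) (b := b - r) (by omega) (by omega)
  have p1 := beta_even (by omega) hb (fun _ => hIH) hE
  have p2 := hIH (a + 1) (b - 1) r (by omega) (by omega) (by omega)
  have e1 : a + (r + 1) = a + r + 1 := by omega
  have e2 : b - (r + 1) = b - r - 1 := by omega
  have e3 : a + 1 + r = a + r + 1 := by omega
  have e4 : b - 1 - r = b - r - 1 := by omega
  rw [e1, e2] at p1 hE
  rw [e3, e4] at p2
  unfold OJ at hfin ⊢
  rw [← e] at hfin ⊢
  exact alphaS hQ (good_TP (by omega) (by omega)) _ _ hE p1 p2 hfin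

lemma even_odd {a b : ℕ} (hb : b ≤ n) (hIH : ∀ l < b - a, PL K n l) (g : ℕ) :
    (∀ r, b = a + 2 * r + 1 + g →
      Frob (TT K n (a + r) (b - r)) (MvPolynomial (Fin n) K) (EJ K n a b r)) ∧
    (∀ r, b = a + 2 * r + 2 + g →
      Frob (TP K n (a + r) (b - r)) (MvPolynomial (Fin n) K) (OJ K n a b r)) := by
  induction g with
  | zero => exact ⟨fun r h => even_base h hb, fun r h => odd_base h hb⟩
  | succ g ih =>
    refine ⟨fun r h => ?_, fun r h => ?_⟩
    · exact odd_to_even (by omega) hb (hIH _ (by omega)) (ih.2 r (by omega))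
    · exact even_to_odd (by omega) hb (hIH _ (by omega)) (ih.1 (r + 1) (by omega))

lemma PL_all (l : ℕ) : PL K n l := by
  induction l using Nat.strong_induction_on with
  | _ l ih =>
    intro a b r h hb hr
    refine beta_even (by omega) hb (fun _ => ih _ (by omega)) ?_
    exact (even_odd hb (fun l' hl' => ih l' (by omega)) (b - (a + 2 * r + 1))).1 r (by omega)

lemma gor_even {a b r : ℕ} (h : a + 2 * r + 1 ≤ b) (hb : b ≤ n) :
    IsGorensteinRing (MvPolynomial (Fin n) K ⧸ EJ K n a b r) := by
  obtain ⟨_, d, hd⟩ := good_TT (K := K) (n := n) (a + r) (b - r)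
  exact ((even_odd hb (fun l _ => PL_all l) (b - (a + 2 * r + 1))).1 r (by omega)).gorenstein hd

lemma gor_odd {a b r : ℕ} (h : a + 2 * r + 2 ≤ b) (hb : b ≤ n) :
    IsGorensteinRing (MvPolynomial (Fin n) K ⧸ OJ K n a b r) := by
  obtain ⟨_, d, hd⟩ := good_TP (K := K) (n := n) (a := a + r) (b := b - r) (by omega) (by omega)
  exact ((even_odd hb (fun l _ => PL_all l) (b - (a + 2 * r + 2))).2 r (by omega)).gorenstein hd

lemma gor_one {m t : ℕ} (ht2 : 2 ≤ t) (htm : t ≤ m) :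
    IsGorensteinRing (MvPolynomial (Fin (2 * m - 1)) K ⧸
      (minorsIdeal t (hankelX K m) + minorsIdeal (t - 1) (hankelQ K m))) := by
  have h1 := gor_odd (K := K) (n := 2 * m - 1) (a := 0) (b := 2 * m - 1) (r := t - 2)
    (by omega) le_rfl
  have e := inf_eq1 (K := K) (n := 2 * m - 1) (a := 0) (b := 2 * m - 1) (s := t - 2 + 1) le_rfl
    (by omega) (by omega)
  unfold OJ at h1
  rw [← e] at h1
  have e1 : t - 2 + 1 + 1 = t := by omega
  have e2 : t - 2 + 1 = t - 1 := by omega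
  rw [e1, e2] at h1
  rw [minorsX m t (by omega), minorsQ m (t - 1) (by omega)]
  exact h1

lemma gor_two {m t : ℕ} (ht2 : 2 ≤ t) (htm : t ≤ m) :
    IsGorensteinRing (MvPolynomial (Fin (2 * m - 1)) K ⧸
      (minorsIdeal (t - 1) (hankelP1 K m) + minorsIdeal (t - 1) (hankelP2 K m))) := by
  have h1 := gor_even (K := K) (n := 2 * m - 1) (a := 0) (b := 2 * m - 1) (r := t - 2)
    (by omega) le_rfl
  have e := inf_eq2 (K := K) (n := 2 * m - 1) (a := 0) (b := 2 * m - 1) (s := t - 2) le_rfl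
    (by omega)
  unfold EJ at h1
  rw [← e] at h1
  have e2 : t - 2 + 1 = t - 1 := by omega
  rw [e2] at h1
  rw [minorsP1 m (t - 1) (by omega), minorsP2 m (t - 1) (by omega)]
  exact h1

end

end HK

/-- **Remark 3.12 / proof of Proposition 3.8.** Let `n = 2m-1`, `X` the generic square Hankel
matrix of size `m`, `P₁` (resp. `P₂`, `Q`) obtained from `X` by dropping the last row (resp.
the first column, resp. both). For the admissible values of `t`, the rings
`S/(I_t(X) + I_{t-1}(Q))` and `S/(I_{t-1}(P₁) + I_{t-1}(P₂))` are Gorenstein, with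
`ht(I_t(X) + I_{t-1}(Q)) = n - 2t + 3` and `ht(I_{t-1}(P₁) + I_{t-1}(P₂)) = n - 2t + 4`;
each sum has height one more than the common height (`n-2t+2`, resp. `n-2t+3`) of its two
summands. -/
theorem hankel_sums_gorenstein {K : Type*} [Field K] (m : ℕ) (t : ℕ)
    (ht2 : 2 ≤ t) (htm : t ≤ m) :
    IsGorensteinRing (MvPolynomial (Fin (2 * m - 1)) K ⧸
        (minorsIdeal t (hankelX K m) + minorsIdeal (t - 1) (hankelQ K m))) ∧
    IsGorensteinRing (MvPolynomial (Fin (2 * m - 1)) K ⧸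
        (minorsIdeal (t - 1) (hankelP1 K m) + minorsIdeal (t - 1) (hankelP2 K m))) ∧
    idealHeight (minorsIdeal t (hankelX K m)) = (2 * (m - t) + 1 : ℕ) ∧
    idealHeight (minorsIdeal (t - 1) (hankelQ K m)) = (2 * (m - t) + 1 : ℕ) ∧
    idealHeight (minorsIdeal t (hankelX K m) + minorsIdeal (t - 1) (hankelQ K m)) =
      (2 * (m - t) + 2 : ℕ) ∧
    idealHeight (minorsIdeal (t - 1) (hankelP1 K m)) = (2 * (m - t) + 2 : ℕ) ∧
    idealHeight (minorsIdeal (t - 1) (hankelP2 K m)) = (2 * (m - t) + 2 : ℕ) ∧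
    idealHeight (minorsIdeal (t - 1) (hankelP1 K m) + minorsIdeal (t - 1) (hankelP2 K m)) =
      (2 * (m - t) + 3 : ℕ) := by
  exact ⟨HK.gor_one ht2 htm, HK.gor_two ht2 htm, HK.heights m t ht2 htm⟩
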